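/- arXiv:2209.04657 — 3 statements merged into one kernel-verified Lean document; each statement's English description precedes it below -/
import Mathlib

section
/- Let m,n be integers with n ≥ m ≥ 1. (1) There is a unique integer t ≥ 1 such that φ^(m)(n) = β^(m)(t); equivalently, C(A^(m)[1,φ^(m)(n)]) ≤ m and the number of indices i with 1 ≤ i ≤ φ^(m)(n) and A^(m)(i) = m equals (m+1)^{t−1} for exactly one t ≥ 1. (2) If moreover n ≥ m+1, then for this t = t^(m)(n) one has T_{t^(m)(n)}^(m) = B_{t^(m+1)(n)}^(m+1); in particular τ^(m)(t^(m)(n)) = β^(m+1)(t^(m+1)(n)). -/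
open List Filter

open scoped Classical

noncomputable section

/-- The curling number of a finite string: the largest `k` such that
`S = X ++ Y^k` with `Y` nonempty; by convention `curl [] = 1`. -/
def curl (S : List ℕ) : ℕ :=
  max 1 (sSup {k | ∃ X Y : List ℕ, Y ≠ [] ∧ S = X ++ (List.replicate k Y).flatten})

/-- The prefix of length `n` of the level-`m` Gijswijt sequence `A^(m)`. -/
def gPrefix (m : ℕ) : ℕ → List ℕ
  | 0 => []
  | n + 1 => gPrefix m n ++ [max m (curl (gPrefix m n))]

/-- `gij m p` is the `p`-th term (1-indexed) of the level-`m` Gijswijt sequence `A^(m)`. -/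
def gij (m p : ℕ) : ℕ := max m (curl (gPrefix m (p - 1)))

/-- Standing hypothesis: for every `m ≥ 1`, the sets
`{k ≥ 0 : C(A^(m)[1,k]) ≤ m}` and `{k ≥ 0 : C(A^(m+1)[1,k]) ≤ m}` are infinite. -/
def StandingHyp : Prop :=
  ∀ m : ℕ, 1 ≤ m →
    {k : ℕ | curl (gPrefix m k) ≤ m}.Infinite ∧
    {k : ℕ | curl (gPrefix (m + 1) k) ≤ m}.Infinite

/-- Length of `π^(m)(1,x)`: the `x`-th smallest (0-indexed) element of
`{k : C(A^(m)[1,k]) ≤ m}`. -/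
def piLen (m x : ℕ) : ℕ := Nat.nth (fun k => curl (gPrefix m k) ≤ m) x

/-- `π^(m)(1,x)`: the prefix of `A^(m)` with exactly `x` occurrences of `m`
and curling number at most `m`. -/
def piStr (m x : ℕ) : List ℕ := gPrefix m (piLen m x)

/-- `β^(m)(t)`, the length of `B_t^(m)`. -/
def beta (m t : ℕ) : ℕ := piLen m ((m + 1) ^ (t - 1))

/-- `B_t^(m) := π^(m)(1,(m+1)^(t-1))`. -/
def Bstr (m t : ℕ) : List ℕ := piStr m ((m + 1) ^ (t - 1))

/-- `τ^(m)(t)`, the length of `T_t^(m)`. -/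
def tau (m t : ℕ) : ℕ := Nat.nth (fun k => curl (gPrefix (m + 1) k) ≤ m) (t - 1)

/-- `T_t^(m)`: the `t`-th shortest prefix of `A^(m+1)` with curling number at most `m`. -/
def Tstr (m t : ℕ) : List ℕ := gPrefix (m + 1) (tau m t)

/-- `φ^(m)(n)`: the least `p ≥ 1` with `A^(m)(p) = n`. -/
def phi (m n : ℕ) : ℕ := sInf {p : ℕ | 1 ≤ p ∧ gij m p = n}

/-- `t^(m)(n) = 1 + log_{m+1} #\{i ≤ φ^(m)(n) : A^(m)(i) = m\}`. -/
def tfun (m n : ℕ) : ℕ := 1 + Nat.log (m + 1) ((gPrefix m (phi m n)).count m)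

/-- `χ^(b)(a)`: read the base-`b` digits of `a` as base-`(b+1)` digits. -/
def chi (b a : ℕ) : ℕ := Nat.ofDigits (b + 1) (Nat.digits b a)

/-- `ι_m(t)`: read the base-`(m+2)` digits of the number of occurrences of `m+1`
in `T_t^(m)` as base-`(m+1)` digits. -/
def iota (m t : ℕ) : ℕ :=
  Nat.ofDigits (m + 1) (Nat.digits (m + 2) ((Tstr m t).count (m + 1)))

/-- `ι_m⁻¹(p)`: the largest `x ≥ 1` with `ι_m(x) ≤ p`. -/
def iotaInv (m p : ℕ) : ℕ := sSup {x : ℕ | 1 ≤ x ∧ iota m x ≤ p}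

/-- `ord_b(n)`: the `b`-adic valuation of `n`. -/
def ordb (b n : ℕ) : ℕ := sSup {z : ℕ | b ^ z ∣ n}

/-- The largest base-`b` digit of `n`. -/
def maxdigit (b n : ℕ) : ℕ := (Nat.digits b n).foldr max 0

/-- Auxiliary function for the level-`m` expansion: `lexpAux m a k = a_{m+1+k}`. -/
def lexpAux (m a : ℕ) : ℕ → ℕ
  | 0 => a
  | k + 1 => iota (m + 1 + k) (ordb (m + 1 + k) (lexpAux m a k) + 1)

/-- `lexp m a l = a_l`, the `l`-th term of the level-`m` expansion of `a`. -/
def lexp (m a l : ℕ) : ℕ := lexpAux m a (l - (m + 1))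

/-- The last element `n` of `π^(m+1)(1, χ^(m+1)(a))`; the level-`m` expansion
of `a` is `a_{m+1}, …, a_n`. -/
def levelEnd (m a : ℕ) : ℕ := (piStr (m + 1) (chi (m + 1) a)).getLastD 0

/-- `V_m := {v ≥ 0 : C(T_{v+1}^(m+1)) ≤ m}`. -/
def Vset (m : ℕ) : Set ℕ := {v | curl (Tstr (m + 1) (v + 1)) ≤ m}

/-- `Q := {α ≥ 0 : C(T_{α+1}^(2)) = 1}`. -/
def Qset : Set ℕ := {a | curl (Tstr 2 (a + 1)) = 1}

/-- `R := {(a,b) : a ∈ Q, a < b, no suffix S of T_{a+1}^(2) with T_{a+1}^(2)·S = T_{b+1}^(2)}`. -/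
def Rset : Set (ℕ × ℕ) :=
  {p | p.1 ∈ Qset ∧ p.1 < p.2 ∧
    ¬∃ S : List ℕ, S <:+ Tstr 2 (p.1 + 1) ∧ Tstr 2 (p.1 + 1) ++ S = Tstr 2 (p.2 + 1)}

/-- The digit of `x` in base `b` at (1-indexed) position `i`, i.e. the coefficient
of `b^(i-1)`. -/
def digitAt (b x i : ℕ) : ℕ := (Nat.digits b x).getD (i - 1) 0

/-- `u` is the (1-indexed) position of the second nonzero base-`b` digit of `x`
(the first nonzero digit being at position `ord_b(x)+1`). -/
def IsSecondNonzero (b x u : ℕ) : Prop :=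
  ordb b x + 1 < u ∧ digitAt b x u ≠ 0 ∧
    ∀ i, ordb b x + 1 < i → i < u → digitAt b x i = 0

/-- `𝒮_b`: pairs `(a,a')` with `1 ≤ a < a'` such that for some position `y` the
base-`b` digits of `a` and `a'` agree away from `y` and twice the `y`-th digit of `a`
is at least the `y`-th digit of `a'`. -/
def Sset (b : ℕ) : Set (ℕ × ℕ) :=
  {p | 1 ≤ p.1 ∧ p.1 < p.2 ∧
    ∃ y : ℕ, (∀ i, i ≠ y → (Nat.digits b p.1).getD i 0 = (Nat.digits b p.2).getD i 0) ∧
      (Nat.digits b p.2).getD y 0 ≤ 2 * (Nat.digits b p.1).getD y 0}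

/-- The glue string `S_t^(m)`, so that `T_{t+1}^(m) = T_t^(m) ++ glue m t`. -/
def glue (m t : ℕ) : List ℕ := (gPrefix (m + 1) (tau m (t + 1))).drop (tau m t)

/-- The strings `P_t^(m)`: `P_1^(m) = (m)` and `P_{t+1}^(m) = P_t^(m)·B_t^(m)·S_t^(m)`. -/
def Pstr (m : ℕ) : ℕ → List ℕ
  | 0 => []
  | 1 => [m]
  | t + 2 => Pstr m (t + 1) ++ Bstr m (t + 1) ++ glue m (t + 1)

end

/-- The curling number of the length-`n` prefix of the sequence `w`. -/
noncomputable def seqCurl (w : ℕ → ℕ) (n : ℕ) : ℕ := curl ((List.range n).map w)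

/-- The length-`n` prefix of `w` ends in a `k`-th power of a string of length `l`. -/
def PowSuffix (w : ℕ → ℕ) (n k l : ℕ) : Prop :=
  0 < l ∧ k * l ≤ n ∧ ∀ i, n ≤ i + k * l → i + l < n → w i = w (i + l)

theorem map_range_eq_flatten_replicate {f : ℕ → ℕ} {l : ℕ} (k : ℕ)
    (h : ∀ i, i + l < k * l → f i = f (i + l)) :
    (List.range (k * l)).map f = (List.replicate k ((List.range l).map f)).flatten := by
  induction k with
  | zero => simp
  | succ k ih =>
    rw [List.replicate_succ, List.flatten_cons, ← ih (fun i hi => h i (by nlinarith)),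
      show (k + 1) * l = l + k * l by ring, List.range_add, List.map_append, List.map_map]
    congr 1
    apply List.map_congr_left
    intro i hi
    rw [List.mem_range] at hi
    simp only [Function.comp]
    rw [add_comm l i]
    exact (h i (by nlinarith)).symm

theorem length_flatten_replicate_eq (k : ℕ) (Y : List ℕ) :
    (List.replicate k Y).flatten.length = k * Y.length := by
  simp

theorem flatten_replicate_periodic (k : ℕ) (Y : List ℕ) (i : ℕ)
    (hi : i + Y.length < k * Y.length) :
    (List.replicate k Y).flatten[i]? = (List.replicate k Y).flatten[i + Y.length]? := by
  obtain _ | k := k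
  · omega
  have hi' : i < k * Y.length := by nlinarith
  conv_rhs => rw [List.replicate_succ, List.flatten_cons,
    List.getElem?_append_right (Nat.le_add_left _ _), Nat.add_sub_cancel]
  rw [List.replicate_succ', List.flatten_append, List.getElem?_append_left (by simpa using hi')]

theorem PowSuffix.mono {w : ℕ → ℕ} {n k k' l : ℕ} (h : PowSuffix w n k l) (hk : k' ≤ k) :
    PowSuffix w n k' l := by
  have := Nat.mul_le_mul_right l hk
  exact ⟨h.1, by linarith [h.2.1], fun i hi hi' => h.2.2 i (by omega) hi'⟩

theorem le_seqCurl_iff {w : ℕ → ℕ} {n k : ℕ} (hk : 2 ≤ k) :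
    k ≤ seqCurl w n ↔ ∃ l, PowSuffix w n k l := by
  set P := {k | ∃ X Y : List ℕ, Y ≠ [] ∧
    (List.range n).map w = X ++ (List.replicate k Y).flatten} with hP
  have hbdd : BddAbove P := by
    refine ⟨n, ?_⟩
    rintro k ⟨X, Y, hY, h⟩
    have hl := congrArg List.length h
    rw [List.length_append, length_flatten_replicate_eq, List.length_map, List.length_range] at hl
    have := List.length_pos_of_ne_nil hY
    nlinarith
  have hne : P.Nonempty := ⟨0, (List.range n).map w, [0], by simp, by simp⟩
  have hcurl : seqCurl w n = max 1 (sSup P) := rfl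
  constructor
  · intro h
    have hk' : k ≤ sSup P := by
      rw [hcurl] at h
      rcases le_max_iff.1 h with h | h
      · omega
      · exact h
    obtain ⟨X, Y, hY, h⟩ := Nat.sSup_mem hne hbdd
    generalize sSup P = K at hk' h
    refine ⟨Y.length, PowSuffix.mono ?_ hk'⟩
    have hl := congrArg List.length h
    rw [List.length_append, length_flatten_replicate_eq, List.length_map, List.length_range] at hl
    refine ⟨List.length_pos_of_ne_nil hY, by omega, fun i hi hi' => ?_⟩
    have key : ∀ j, X.length + j < n →
        (List.replicate K Y).flatten[j]? = some (w (X.length + j)) := by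
      intro j hj
      have h1 : ((List.range n).map w)[X.length + j]? = some (w (X.length + j)) := by
        simp [hj]
      rw [← h1, h, List.getElem?_append_right (Nat.le_add_right _ _), Nat.add_sub_cancel_left]
    obtain ⟨j, rfl⟩ : ∃ j, i = X.length + j := ⟨i - X.length, by omega⟩
    have h2 := flatten_replicate_periodic K Y j (by omega)
    rw [key j (by omega), key _ (by omega)] at h2
    rw [add_assoc]
    exact Option.some.inj h2
  · rintro ⟨l, hl, hle, hper⟩
    rw [hcurl]
    refine le_max_of_le_right (le_csSup hbdd ?_)
    obtain ⟨a, rfl⟩ := Nat.exists_eq_add_of_le' hle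
    refine ⟨(List.range a).map w, (List.range l).map (fun i => w (a + i)), ?_, ?_⟩
    · simp [List.range_eq_nil]; omega
    · rw [← map_range_eq_flatten_replicate k, List.range_add, List.map_append, List.map_map]
      · rfl
      · intro i hi
        rw [← add_assoc]
        exact hper _ (by omega) (by omega)

theorem one_le_seqCurl (w : ℕ → ℕ) (n : ℕ) : 1 ≤ seqCurl w n := le_max_left _ _

theorem PowSuffix.eq_add_mul {w : ℕ → ℕ} {n k l : ℕ} (h : PowSuffix w n k l) {i : ℕ}
    (hi : n ≤ i + k * l) (j : ℕ) (hj : i + j * l < n) : w i = w (i + j * l) := by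
  induction j with
  | zero => simp
  | succ j ih =>
    have e : i + (j + 1) * l = i + j * l + l := by ring
    rw [e] at hj ⊢
    rw [ih (by omega), h.2.2 _ (by omega) hj]

theorem PowSuffix.exists_in_last {w : ℕ → ℕ} {n k l : ℕ} (h : PowSuffix w n k l) {i : ℕ}
    (hi : n ≤ i + k * l) (hin : i < n) : ∃ p, n ≤ p + l ∧ p < n ∧ w p = w i := by
  have hl := h.1
  have hd := Nat.div_add_mod (n - 1 - i) l
  have hm := Nat.mod_lt (n - 1 - i) hl
  rw [mul_comm] at hd
  set q := (n - 1 - i) / l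
  exact ⟨i + q * l, by omega, by omega, (h.eq_add_mul hi q (by omega)).symm⟩

/-- A sequence `w` built from runs: the `x`-th run is `m` followed by the first `τ (v x)` terms
of the level-`(m+1)` sequence `c`, where `v` is the valuation in base `m+1` and `τ` enumerates
the prefixes of `c` with curling number at most `m`; `d x` is the total length of the first
`x` runs. -/
structure RunModel (m : ℕ) (c w d v τ : ℕ → ℕ) : Prop where
  one_le : 1 ≤ m
  pow_dvd : ∀ n, 0 < n → ∀ k, (m + 1) ^ k ∣ n ↔ k ≤ v n
  strictMono_τ : StrictMono τ
  curl_le_iff : ∀ r, seqCurl c r ≤ m ↔ ∃ j, τ j = r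
  c_eq : ∀ r, c r = max (m + 1) (seqCurl c r)
  d_zero : d 0 = 0
  d_succ : ∀ x, d (x + 1) = d x + 1 + τ (v (x + 1))
  w_start : ∀ x, w (d x) = m
  w_run : ∀ x r, r < τ (v (x + 1)) → w (d x + 1 + r) = c r

namespace RunModel

variable {m : ℕ} {c w d v τ : ℕ → ℕ}

theorem lt_c (M : RunModel m c w d v τ) (r : ℕ) : m < c r := by
  rw [M.c_eq]; exact lt_max_of_lt_left (Nat.lt_succ_self m)

theorem strictMono_d (M : RunModel m c w d v τ) : StrictMono d :=
  strictMono_nat_of_lt_succ fun x => by rw [M.d_succ]; omega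

theorem exists_run (M : RunModel m c w d v τ) (n : ℕ) :
    ∃ x s, n = d x + s ∧ s ≤ τ (v (x + 1)) := by
  induction n with
  | zero => exact ⟨0, 0, by simp [M.d_zero], Nat.zero_le _⟩
  | succ n ih =>
    obtain ⟨x, s, rfl, hs⟩ := ih
    rcases hs.lt_or_eq with hs | hs
    · exact ⟨x, s + 1, by omega, hs⟩
    · exact ⟨x + 1, 0, by rw [M.d_succ]; omega, Nat.zero_le _⟩

theorem w_eq_iff (M : RunModel m c w d v τ) (n : ℕ) : w n = m ↔ ∃ x, n = d x := by
  constructor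
  · intro h
    obtain ⟨x, s, rfl, hs⟩ := M.exists_run n
    obtain _ | s := s
    · exact ⟨x, rfl⟩
    · have := M.w_run x s hs
      rw [show d x + (s + 1) = d x + 1 + s by ring] at h
      have := M.lt_c s
      omega
  · rintro ⟨x, rfl⟩
    exact M.w_start x

theorem v_add (M : RunModel m c w d v τ) {j y z : ℕ} (hy : (m + 1) ^ j ∣ y) (hz : 0 < z)
    (hzj : z < (m + 1) ^ j) : v (y + z) = v z := by
  have key : ∀ k, k ≤ v (y + z) ↔ k ≤ v z := by
    intro k
    rw [← M.pow_dvd _ (by omega), ← M.pow_dvd _ hz]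
    rcases le_total k j with hk | hk
    · exact (Nat.dvd_add_iff_right ((pow_dvd_pow _ hk).trans hy)).symm
    · have hn : ¬ (m + 1) ^ j ∣ z := fun h => absurd (Nat.le_of_dvd hz h) (by omega)
      constructor
      · intro h
        exact absurd ((Nat.dvd_add_iff_right hy).2 ((pow_dvd_pow _ hk).trans h)) hn
      · intro h
        exact absurd ((pow_dvd_pow _ hk).trans h) hn
  exact le_antisymm ((key _).1 le_rfl) ((key _).2 le_rfl)

theorem v_eq_of (M : RunModel m c w d v τ) {n k : ℕ} (hn : 0 < n) (h : (m + 1) ^ k ∣ n)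
    (h' : ¬ (m + 1) ^ (k + 1) ∣ n) : v n = k := by
  rw [M.pow_dvd n hn] at h h'
  omega

theorem v_mul_pow (M : RunModel m c w d v τ) {e j : ℕ} (he : ¬ (m + 1) ∣ e) :
    v (e * (m + 1) ^ j) = j := by
  have hpos : 0 < (m + 1) ^ j := by positivity
  refine M.v_eq_of (Nat.mul_pos (Nat.pos_of_ne_zero ?_) hpos) (Dvd.intro_left _ rfl) ?_
  · rintro rfl; simp at he
  · rw [pow_succ', Nat.mul_dvd_mul_iff_right hpos]; exact he

theorem v_pow (M : RunModel m c w d v τ) (j : ℕ) : v ((m + 1) ^ j) = j := by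
  have := M.one_le
  simpa using M.v_mul_pow (e := 1) (j := j) (by simp; omega)

theorem d_add (M : RunModel m c w d v τ) {j y : ℕ} (hy : (m + 1) ^ j ∣ y) (z : ℕ)
    (hz : z < (m + 1) ^ j) : d (y + z) = d y + d z := by
  induction z with
  | zero => simp [M.d_zero]
  | succ z ih =>
    rw [← add_assoc, M.d_succ, M.d_succ, ih (by omega), add_assoc y,
      M.v_add hy (Nat.succ_pos z) hz]
    ring

theorem d_add_pow (M : RunModel m c w d v τ) {j y : ℕ} (hy : (m + 1) ^ j ∣ y) :
    d (y + (m + 1) ^ j) + τ j = d y + d ((m + 1) ^ j) + τ (v (y + (m + 1) ^ j)) := by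
  obtain ⟨z, hz⟩ : ∃ z, (m + 1) ^ j = z + 1 :=
    ⟨(m + 1) ^ j - 1, by have : 0 < (m + 1) ^ j := by positivity
                         omega⟩
  have h1 := M.d_add hy z (by omega)
  have h2 := M.d_succ z
  have h3 := M.d_succ (y + z)
  rw [← hz, M.v_pow] at h2
  rw [add_assoc y, ← hz] at h3
  omega

theorem w_block (M : RunModel m c w d v τ) {j y i : ℕ} (hy : (m + 1) ^ j ∣ y)
    (hi : i < d ((m + 1) ^ j)) : w (d y + i) = w i := by
  obtain ⟨z, s, rfl, hs⟩ := M.exists_run i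
  have hz : z < (m + 1) ^ j := M.strictMono_d.lt_iff_lt.1 (by omega)
  rw [← add_assoc, ← M.d_add hy z hz]
  obtain _ | s := s
  · simp [M.w_start]
  · have hle : v (z + 1) ≤ v (y + z + 1) := by
      rw [← M.pow_dvd _ (by omega)]
      have h1 : (m + 1) ^ v (z + 1) ∣ z + 1 := (M.pow_dvd _ (by omega) _).2 le_rfl
      have h2 : v (z + 1) ≤ j :=
        (Nat.pow_le_pow_iff_right (by have := M.one_le; omega : 1 < m + 1)).1
          ((Nat.le_of_dvd (by omega) h1).trans hz)
      rw [add_assoc]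
      exact dvd_add ((pow_dvd_pow _ h2).trans hy) h1
    have := M.w_run z s hs
    have := M.w_run (y + z) s (lt_of_lt_of_le hs (M.strictMono_τ.monotone hle))
    rw [show d (y + z) + (s + 1) = d (y + z) + 1 + s by ring,
      show d z + (s + 1) = d z + 1 + s by ring]
    omega

theorem powSuffix_run (M : RunModel m c w d v τ) {x j : ℕ} (hj : j < v (x + 1)) :
    PowSuffix w (d x + 1 + τ j) (m + 1) (d ((m + 1) ^ j)) := by
  have hb : 0 < (m + 1) ^ j := by positivity
  have hdvd : (m + 1) ^ (j + 1) ∣ x + 1 := (M.pow_dvd _ (by omega) _).2 hj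
  have hle := Nat.le_of_dvd (by omega) hdvd
  obtain ⟨y, hy⟩ := Nat.exists_eq_add_of_le' hle
  have hy1 : (m + 1) ^ (j + 1) ∣ y := by
    rw [hy] at hdvd
    exact (Nat.dvd_add_iff_left dvd_rfl).2 hdvd
  have hyj : ∀ e, (m + 1) ^ j ∣ y + e * (m + 1) ^ j := fun e =>
    dvd_add ((pow_dvd_pow _ (Nat.le_succ j)).trans hy1) (Dvd.intro_left _ rfl)
  set l := d ((m + 1) ^ j) with hl
  have hlpos : 0 < l := by
    have := M.strictMono_d hb
    omega
  have hstart : ∀ e, e ≤ m → d (y + e * (m + 1) ^ j) = d y + e * l := by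
    intro e
    induction e with
    | zero => simp
    | succ e ih =>
      intro he
      have h1 := M.d_add_pow (hyj e)
      have h2 : v (y + e * (m + 1) ^ j + (m + 1) ^ j) = j := by
        have h3 : y + e * (m + 1) ^ j + (m + 1) ^ j = y + (e + 1) * (m + 1) ^ j := by ring
        rw [h3, M.v_add hy1 (by positivity), M.v_mul_pow]
        · intro h; have := Nat.le_of_dvd (by omega) h; omega
        · rw [pow_succ']; exact Nat.mul_lt_mul_of_pos_right (by omega) hb
      rw [h2, ih (by omega)] at h1
      rw [show y + (e + 1) * (m + 1) ^ j = y + e * (m + 1) ^ j + (m + 1) ^ j by ring]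
      linarith
  have hend : d x + 1 + τ j = d y + (m + 1) * l := by
    have h1 := M.d_add_pow (hyj m)
    rw [show y + m * (m + 1) ^ j + (m + 1) ^ j = x + 1 by rw [hy]; ring, hstart m le_rfl] at h1
    have h2 := M.d_succ x
    have : (m + 1) * l = m * l + l := by ring
    omega
  have hw : ∀ p, p < (m + 1) * l → w (d y + p) = w (p % l) := by
    intro p hp
    have h1 := Nat.div_add_mod p l
    have h2 : p / l < m + 1 := Nat.div_lt_of_lt_mul (by rwa [mul_comm])
    rw [← M.w_block (hyj (p / l)) (Nat.mod_lt p hlpos), hstart _ (by omega), mul_comm (p / l) l,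
      add_assoc, h1]
  rw [hend]
  refine ⟨hlpos, by omega, fun i hi hi' => ?_⟩
  obtain ⟨p, rfl⟩ : ∃ p, i = d y + p := ⟨i - d y, by omega⟩
  rw [add_assoc, hw _ (by omega), hw _ (by omega), Nat.add_mod_right]

/-- A power whose base is free of `m` lies inside the last run. -/
theorem powSuffix_tail (M : RunModel m c w d v τ) {x r k l : ℕ} (hr : r ≤ τ (v (x + 1)))
    (h : PowSuffix w (d x + 1 + r) k l)
    (hfree : ∀ p, d x + 1 + r ≤ p + l → p < d x + 1 + r → w p ≠ m) : PowSuffix c r k l := by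
  have hle : k * l ≤ r := by
    by_contra hlt
    obtain ⟨p, hp, hpn, hpw⟩ := h.exists_in_last (i := d x) (by omega) (by omega)
    exact hfree p hp hpn (hpw.trans (M.w_start x))
  refine ⟨h.1, hle, fun i hi hi' => ?_⟩
  have := h.2.2 (d x + 1 + i) (by omega) (by omega)
  rw [add_assoc (d x + 1), M.w_run _ _ (by omega), M.w_run _ _ (by omega)] at this
  exact this

theorem powSuffix_of_tail (M : RunModel m c w d v τ) {x r k l : ℕ} (hr : r ≤ τ (v (x + 1)))
    (h : PowSuffix c r k l) : PowSuffix w (d x + 1 + r) k l := by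
  have := h.2.1
  refine ⟨h.1, by omega, fun i hi hi' => ?_⟩
  obtain ⟨p, rfl⟩ : ∃ p, i = d x + 1 + p := ⟨i - (d x + 1), by omega⟩
  rw [add_assoc (d x + 1), M.w_run _ _ (by omega), M.w_run _ _ (by omega)]
  exact h.2.2 p (by omega) (by omega)

end RunModel

/-- A power whose base contains `m` has exponent at most `m + 1`. -/
theorem PowSuffix.le_of_mem {m : ℕ} {w : ℕ → ℕ} {n k l p : ℕ} (hm : 1 ≤ m)
    (h : PowSuffix w n k l) (hp : n ≤ p + l) (hpn : p < n) (hcurl : seqCurl w p ≤ m) :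
    k ≤ m + 1 := by
  by_contra! hk
  obtain ⟨k, rfl⟩ : ∃ k', k = k' + 1 := ⟨k - 1, by omega⟩
  have hle := h.2.1
  have e : (k + 1) * l = k * l + l := by ring
  have : k ≤ seqCurl w p := (le_seqCurl_iff (by omega)).2
    ⟨l, h.1, by omega, fun i hi hi' => h.2.2 i (by omega) (by omega)⟩
  omega

namespace RunModel

variable {m : ℕ} {c w d v τ : ℕ → ℕ}

/-- Almost periodic valuations in a window of length `(m+1)q` only occur for `m = 1`. -/
theorem valuation_window (M : RunModel m c w d v τ) {x q : ℕ} (hq : 0 < q)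
    (hx : (m + 1) * q ≤ x) (hper : ∀ z, x < z + m * q → z < x → v z = v (z - q))
    (hlast : v x ≤ v (x - q)) : m = 1 ∧ 2 * q < x ∧ v (x - 2 * q) = v x ∧ v x < v (x - q) := by
  have hm := M.one_le
  have hB : 0 < (m + 1) ^ (v q + 1) := by positivity
  have hqdvd : (m + 1) ^ v q ∣ q := (M.pow_dvd q hq _).2 le_rfl
  have hqn : ¬ (m + 1) ^ (v q + 1) ∣ q := fun h => by
    have := (M.pow_dvd q hq _).1 h; omega
  have hBq : (m + 1) ^ (v q + 1) ≤ (m + 1) * q := by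
    rw [pow_succ']; exact Nat.mul_le_mul_left _ (Nat.le_of_dvd hq hqdvd)
  have hmq : (m + 1) * q = m * q + q := by ring
  have hqmq : q ≤ m * q := Nat.le_mul_of_pos_left q hm
  set B := (m + 1) ^ (v q + 1) with hBdef
  have hdm := Nat.div_add_mod x B
  have hml := Nat.mod_lt x hB
  have hzpos : 0 < B * (x / B) := Nat.mul_pos hB (Nat.div_pos (by omega) hB)
  have hzB : B ∣ B * (x / B) := Dvd.intro _ rfl
  set z := B * (x / B) with hz
  have hvz : v q + 1 ≤ v z := (M.pow_dvd z hzpos _).1 hzB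
  have hsub : q < z → v (z - q) = v q := fun h => by
    refine M.v_eq_of (by omega) (Nat.dvd_sub ((pow_dvd_pow _ (Nat.le_succ _)).trans hzB) hqdvd)
      fun h' => hqn ?_
    have h2 := Nat.dvd_sub hzB h'
    rwa [Nat.sub_sub_self h.le] at h2
  have hadd : v (z + q) = v q := by
    refine M.v_eq_of (by omega) (dvd_add ((pow_dvd_pow _ (Nat.le_succ _)).trans hzB) hqdvd)
      fun h' => hqn ((Nat.dvd_add_iff_right hzB).2 h')
  have hzq : z ≠ q := fun h => hqn (h ▸ hzB)
  have hzx : z ≠ x := fun h => by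
    have := hsub (by omega)
    rw [← h] at hlast
    omega
  have hz1 : z + m * q ≤ x := by
    by_contra! h
    have := hper z h (by omega)
    rw [hsub (by omega)] at this
    omega
  have hz2 : x ≤ z + q := by
    by_contra! h
    have := hper (z + q) (by omega) h
    rw [hadd, Nat.add_sub_cancel] at this
    omega
  have hm1 : m = 1 := by
    by_contra hne
    have : 2 * q ≤ m * q := Nat.mul_le_mul_right q (by omega)
    omega
  subst hm1
  have hxz : x = z + q := by omega
  have hqz : q < z := by
    have := Nat.le_of_dvd hzpos hzB
    omega
  have e1 : x - 2 * q = z - q := by omega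
  have e2 : x - q = z := by omega
  rw [e1, e2, hsub hqz, hxz, hadd]
  exact ⟨rfl, by omega, rfl, hvz⟩

/-- Prefixes consisting of complete runs have curling number at most `m`. -/
theorem seqCurl_d_le (M : RunModel m c w d v τ) (x : ℕ)
    (hprev : ∀ p, p < d x → w p = m → seqCurl w p ≤ m) : seqCurl w (d x) ≤ m := by
  have hm := M.one_le
  by_contra! hlt
  obtain ⟨l, hP⟩ := (le_seqCurl_iff (k := m + 1) (by omega)).1 hlt
  obtain ⟨hl, hle, hper⟩ := hP
  have hP : PowSuffix w (d x) (m + 1) l := ⟨hl, hle, hper⟩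
  have hml : (m + 1) * l = m * l + l := by ring
  have hlml : l ≤ m * l := Nat.le_mul_of_pos_left l hm
  obtain _ | x := x
  · rw [M.d_zero] at hle; omega
  have hd := M.d_succ x
  have hmono := M.strictMono_d
  by_cases hfree : ∀ p, d (x + 1) ≤ p + l → p < d (x + 1) → w p ≠ m
  · rw [hd] at hP hfree
    have h1 := M.powSuffix_tail le_rfl hP hfree
    have h2 : m + 1 ≤ seqCurl c (τ (v (x + 1))) := (le_seqCurl_iff (by omega)).2 ⟨l, h1⟩
    have h3 := (M.curl_le_iff _).2 ⟨v (x + 1), rfl⟩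
    omega
  push Not at hfree
  obtain ⟨p, hp, hpn, hpm⟩ := hfree
  -- Occurrences of `m` correspond under translation by `l`.
  have hback : ∀ y, d y < d (x + 1) → d (x + 1) ≤ d y + m * l → ∃ z, d z + l = d y := by
    intro y hy hy'
    have h1 := hper (d y - l) (by omega) (by omega)
    rw [Nat.sub_add_cancel (by omega), M.w_start, M.w_eq_iff] at h1
    obtain ⟨z, hz⟩ := h1
    exact ⟨z, by omega⟩
  have hfwd : ∀ z, d (x + 1) ≤ d z + (m + 1) * l → d z + l < d (x + 1) → ∃ y, d y = d z + l := by
    intro z hz hz'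
    have h1 := (hper (d z) hz hz').symm
    rw [M.w_start, M.w_eq_iff] at h1
    obtain ⟨y, hy⟩ := h1
    exact ⟨y, hy.symm⟩
  have hlast : d (x + 1) ≤ d x + l := by
    obtain ⟨y, rfl⟩ := (M.w_eq_iff p).1 hpm
    have : d y ≤ d x := hmono.monotone (Nat.lt_succ_iff.1 (hmono.lt_iff_lt.1 hpn))
    omega
  obtain ⟨z₀, hz₀⟩ := hback x (by omega) (by omega)
  obtain ⟨q, rfl⟩ : ∃ q, x = z₀ + q :=
    ⟨x - z₀, by have := hmono.lt_iff_lt.1 (show d z₀ < d x by omega); omega⟩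
  have hq : 0 < q := by
    by_contra h
    have : q = 0 := by omega
    subst this
    simp at hz₀; omega
  set n := d (z₀ + q + 1) with hn
  -- Translation by `l` moves the index of an occurrence of `m` by `q`.
  have hshift : ∀ i y, y + i = z₀ + q → n ≤ d y + m * l → q ≤ y ∧ d (y - q) + l = d y := by
    intro i
    induction i with
    | zero =>
      rintro y rfl -
      exact ⟨by omega, by simpa using hz₀⟩
    | succ i ih =>
      intro y hy hyn
      have hyy : d y < d (y + 1) := hmono (Nat.lt_succ_self y)
      obtain ⟨h1, h2⟩ := ih (y + 1) (by omega) (by omega)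
      have hyn' : d (y + 1) < n := hmono (by omega)
      obtain ⟨z, hz⟩ := hback y (by omega) hyn
      have h3 : z < y + 1 - q := hmono.lt_iff_lt.1 (by omega)
      suffices hz' : z = y - q by
        refine ⟨by omega, ?_⟩
        rw [← hz']; exact hz
      by_contra hne
      have h4 : d z < d (y - q) := hmono (by omega)
      have h5 : d (y - q) < d (y + 1 - q) := hmono (by omega)
      obtain ⟨u, hu⟩ := hfwd (y - q) (by omega) (by omega)
      have h6 : y < u := hmono.lt_iff_lt.1 (by omega)
      have h7 : u < y + 1 := hmono.lt_iff_lt.1 (by omega)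
      omega
  have hnext : n ≤ d (z₀ + 1) + l := by
    by_contra! h
    obtain ⟨y, hy⟩ := hfwd (z₀ + 1) (by
      have := hmono (Nat.lt_succ_self z₀)
      simp only [Nat.succ_eq_add_one] at this
      omega) h
    have h1 : z₀ + q < y := hmono.lt_iff_lt.1 (by
      have := hmono (Nat.lt_succ_self z₀)
      simp only [Nat.succ_eq_add_one] at this
      omega)
    have h2 : y < z₀ + q + 1 := hmono.lt_iff_lt.1 (by omega)
    omega
  have hiter : ∀ j, j ≤ m → ∃ y, y + j * q = z₀ + 1 ∧ d y + j * l = d (z₀ + 1) := by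
    intro j
    induction j with
    | zero => intro _; exact ⟨z₀ + 1, by simp, by simp⟩
    | succ j ih =>
      intro hj
      obtain ⟨y, hy, hyd⟩ := ih (by omega)
      have h1 : (j + 1) * l ≤ m * l := Nat.mul_le_mul_right l hj
      have h2 : (j + 1) * l = j * l + l := by ring
      have h3 : (j + 1) * q = j * q + q := by ring
      obtain ⟨h4, h5⟩ := hshift (z₀ + q - y) y (by omega) (by omega)
      exact ⟨y - q, by omega, by omega⟩
  have hmq : (m + 1) * q = m * q + q := by ring
  have hqmq : q ≤ m * q := Nat.le_mul_of_pos_left q hm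
  have hper' : ∀ z, z₀ + q + 1 < z + m * q → z < z₀ + q + 1 → v z = v (z - q) := by
    intro z hz hz'
    obtain ⟨y, hy, hyd⟩ := hiter (m - 1) (by omega)
    obtain ⟨k, rfl⟩ : ∃ k, m = k + 1 := ⟨m - 1, by omega⟩
    rw [Nat.add_sub_cancel] at hy hyd
    have e1 : (k + 1) * q = k * q + q := by ring
    have e2 : (k + 1) * l = k * l + l := by ring
    obtain ⟨z, rfl⟩ : ∃ z', z = z' + 1 := ⟨z - 1, by omega⟩
    have hyz : d y ≤ d z := hmono.monotone (by omega)
    have hzz : d z < d (z + 1) := hmono (by omega)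
    obtain ⟨h1, h2⟩ := hshift (z₀ + q - z) z (by omega) (by omega)
    obtain ⟨h3, h4⟩ := hshift (z₀ + q - (z + 1)) (z + 1) (by omega) (by omega)
    have h5 := M.d_succ z
    have h6 := M.d_succ (z - q)
    rw [show z - q + 1 = z + 1 - q by omega] at h6
    exact M.strictMono_τ.injective (by omega)
  have hd0 := M.d_succ z₀
  have hlast' : v (z₀ + q + 1) ≤ v (z₀ + q + 1 - q) := by
    rw [show z₀ + q + 1 - q = z₀ + 1 by omega]
    exact M.strictMono_τ.le_iff_le.1 (by omega)
  have hfit : (m + 1) * q ≤ z₀ + q + 1 := by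
    obtain ⟨y, hy, -⟩ := hiter m le_rfl
    omega
  obtain ⟨rfl, h2q, hv2, hv1⟩ := M.valuation_window hq hfit hper' hlast'
  -- For `m = 1`, the prefix `τ (v (z₀ + 1))` of `c` would end in a square.
  rw [show z₀ + q + 1 - q = z₀ + 1 by omega] at hv1
  obtain ⟨y, hy, hyd⟩ := hiter 1 le_rfl
  rw [one_mul] at hy hyd
  rw [show z₀ + q + 1 - 2 * q = y by omega] at hv2
  obtain ⟨y, rfl⟩ : ∃ y', y = y' + 1 := ⟨y - 1, by omega⟩
  have hdy := M.d_succ y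
  rw [hv2] at hdy
  have hτ := M.strictMono_τ hv1
  have hyl : d y + 2 * l < n := by
    by_contra! h
    have h0 : d (z₀ + 1) ≤ d (z₀ + q) := hmono.monotone (by omega)
    obtain ⟨u, hu⟩ := hfwd y (by omega) (by omega)
    have h1 : z₀ < u := hmono.lt_iff_lt.1 (by omega)
    have h2 : u < z₀ + 1 := hmono.lt_iff_lt.1 (by omega)
    omega
  have hsq : PowSuffix c (τ (v (z₀ + 1))) 2 (τ (v (z₀ + 1)) - τ (v (z₀ + q + 1))) := by
    refine ⟨by omega, by omega, fun i hi hi' => ?_⟩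
    have h1 := hper (d y + 1 + i) (by omega) (by omega)
    rw [M.w_run y i (by rw [hv2]; omega)] at h1
    rw [h1, ← M.w_run z₀ _ hi']
    congr 1
    omega
  have h2 : 2 ≤ seqCurl c (τ (v (z₀ + 1))) := (le_seqCurl_iff le_rfl).2 ⟨_, hsq⟩
  have h3 := (M.curl_le_iff _).2 ⟨v (z₀ + 1), rfl⟩
  omega

theorem w_eq_max (M : RunModel m c w d v τ) (n : ℕ) : w n = max m (seqCurl w n) := by
  induction n using Nat.strong_induction_on with
  | _ n ih =>
  have hm := M.one_le
  have hprev : ∀ p, p < n → w p = m → seqCurl w p ≤ m := by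
    intro p hp hpm
    have := ih p hp
    rw [hpm] at this
    exact this ▸ le_max_right _ _
  obtain ⟨x, s, rfl, hs⟩ := M.exists_run n
  obtain _ | r := s
  · rw [Nat.add_zero, M.w_start, max_eq_left (M.seqCurl_d_le x hprev)]
  rw [show d x + (r + 1) = d x + 1 + r by ring] at hprev ⊢
  rw [M.w_run x r hs, M.c_eq]
  have hupper : seqCurl w (d x + 1 + r) ≤ max (m + 1) (seqCurl c r) := by
    by_contra! h
    have h1 := lt_of_le_of_lt (le_max_left _ _) h
    have h2 := lt_of_le_of_lt (le_max_right _ _) h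
    obtain ⟨l, hP⟩ := (le_seqCurl_iff (by omega)).1 (le_refl (seqCurl w (d x + 1 + r)))
    by_cases hfree : ∀ p, d x + 1 + r ≤ p + l → p < d x + 1 + r → w p ≠ m
    · have := (le_seqCurl_iff (by omega)).2 ⟨l, M.powSuffix_tail (by omega) hP hfree⟩
      omega
    · push Not at hfree
      obtain ⟨p, hp, hpn, hpm⟩ := hfree
      have := hP.le_of_mem hm hp hpn (hprev p hpn hpm)
      omega
  have hlower : seqCurl c r ≤ seqCurl w (d x + 1 + r) := by
    by_cases h : 2 ≤ seqCurl c r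
    · obtain ⟨l, hP⟩ := (le_seqCurl_iff h).1 le_rfl
      exact (le_seqCurl_iff h).2 ⟨l, M.powSuffix_of_tail (by omega) hP⟩
    · have := one_le_seqCurl w (d x + 1 + r)
      omega
  have hlower' : m + 1 ≤ seqCurl w (d x + 1 + r) := by
    by_cases h : m + 1 ≤ seqCurl c r
    · omega
    · obtain ⟨j, rfl⟩ := (M.curl_le_iff r).1 (by omega)
      exact (le_seqCurl_iff (by omega)).2
        ⟨_, M.powSuffix_run (M.strictMono_τ.lt_iff_lt.1 (Nat.lt_of_succ_le hs))⟩
  omega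

end RunModel

theorem gPrefix_eq_map {m : ℕ} {w : ℕ → ℕ} (hw : ∀ n, w n = max m (seqCurl w n)) (n : ℕ) :
    gPrefix m n = (List.range n).map w := by
  induction n with
  | zero => rfl
  | succ n ih =>
    rw [gPrefix, ih, List.range_succ, List.map_append]
    exact congrArg (fun a => (List.range n).map w ++ [a]) (hw n).symm

theorem gPrefix_eq_map_gij (m n : ℕ) :
    gPrefix m n = (List.range n).map (fun i => gij m (i + 1)) := by
  induction n with
  | zero => rfl
  | succ n ih =>
    rw [gPrefix, List.range_succ, List.map_append, ← ih]
    rfl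

theorem curl_gPrefix (m n : ℕ) :
    curl (gPrefix m n) = seqCurl (fun i => gij m (i + 1)) n := by
  rw [gPrefix_eq_map_gij, seqCurl]

theorem gij_succ_eq_max (m n : ℕ) :
    gij m (n + 1) = max m (seqCurl (fun i => gij m (i + 1)) n) := by
  rw [← curl_gPrefix]; rfl

theorem RunModel.gij_eq {m : ℕ} {c w d v τ : ℕ → ℕ} (M : RunModel m c w d v τ) (n : ℕ) :
    gij m (n + 1) = w n := by
  rw [M.w_eq_max, gij, Nat.add_sub_cancel, gPrefix_eq_map M.w_eq_max, seqCurl]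

/-- The total length of the first `x` runs, when the `x`-th run has length `1 + f x`. -/
def runStart (f : ℕ → ℕ) : ℕ → ℕ
  | 0 => 0
  | x + 1 => runStart f x + 1 + f (x + 1)

theorem exists_run_word (m : ℕ) (c f : ℕ → ℕ) : ∃ w : ℕ → ℕ, (∀ x, w (runStart f x) = m) ∧
    ∀ x r, r < f (x + 1) → w (runStart f x + 1 + r) = c r := by
  have hmono : StrictMono (runStart f) :=
    strictMono_nat_of_lt_succ fun x => by rw [runStart]; omega
  set X : ℕ → ℕ := fun n => Nat.findGreatest (fun x => runStart f x ≤ n) n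
  have hX : ∀ x s, s ≤ f (x + 1) → X (runStart f x + s) = x := by
    intro x s hs
    rw [Nat.findGreatest_eq_iff]
    refine ⟨hmono.le_apply.trans (Nat.le_add_right _ _), fun _ => Nat.le_add_right _ _, ?_⟩
    intro k hk _ hk'
    have h1 : runStart f (x + 1) ≤ runStart f k := hmono.monotone hk
    rw [runStart] at h1
    omega
  refine ⟨fun n => if n = runStart f (X n) then m else c (n - runStart f (X n) - 1), ?_, ?_⟩
  · intro x
    have := hX x 0 (Nat.zero_le _)
    rw [Nat.add_zero] at this
    simp [this]
  · intro x r hr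
    have h1 := hX x (r + 1) hr
    rw [show runStart f x + (r + 1) = runStart f x + 1 + r by ring] at h1
    simp only [h1]
    rw [if_neg (by omega)]
    congr 1
    omega

/-- Structure theorem: the level-`m` sequence is a concatenation of runs, each being `m` followed
by a prefix of the level-`(m+1)` sequence of curling number at most `m`. -/
theorem exists_runModel (hSH : StandingHyp) {m : ℕ} (hm : 1 ≤ m) :
    ∃ d v, RunModel m (fun i => gij (m + 1) (i + 1)) (fun i => gij m (i + 1)) d v
      (Nat.nth fun k => curl (gPrefix (m + 1) k) ≤ m) := by
  set τ := Nat.nth fun k => curl (gPrefix (m + 1) k) ≤ m with hτ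
  have hinf := (hSH m hm).2
  set v : ℕ → ℕ := fun n => multiplicity (m + 1) n
  obtain ⟨w, hw, hw'⟩ := exists_run_word m (fun i => gij (m + 1) (i + 1)) (fun x => τ (v x))
  have M : RunModel m (fun i => gij (m + 1) (i + 1)) w (runStart fun x => τ (v x)) v τ :=
    { one_le := hm
      pow_dvd := fun n hn k => (Nat.finiteMultiplicity_iff.2
        ⟨by omega, hn⟩).pow_dvd_iff_le_multiplicity
      strictMono_τ := Nat.nth_strictMono hinf
      curl_le_iff := fun r => by
        rw [← curl_gPrefix, ← Set.mem_range, hτ, Nat.range_nth_of_infinite hinf]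
        rfl
      c_eq := fun r => gij_succ_eq_max _ _
      d_zero := rfl
      d_succ := fun x => rfl
      w_start := hw
      w_run := hw' }
  have hwe : (fun i => gij m (i + 1)) = w := funext M.gij_eq
  exact ⟨_, v, hwe ▸ M⟩

theorem curl_gPrefix_le_iff (m k : ℕ) : curl (gPrefix m k) ≤ m ↔ gij m (k + 1) = m := by
  rw [gij, Nat.add_sub_cancel, max_eq_left_iff]

theorem count_gPrefix (m n : ℕ) :
    (gPrefix m n).count m = Nat.count (fun k => curl (gPrefix m k) ≤ m) n := by
  induction n with
  | zero => simp [gPrefix]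
  | succ n ih =>
    rw [gPrefix, List.count_append, ih, Nat.count_succ, List.count_singleton]
    simp only [beq_iff_eq, max_eq_left_iff]

theorem count_piLen {m : ℕ} (hinf : {k : ℕ | curl (gPrefix m k) ≤ m}.Infinite) (x : ℕ) :
    (gPrefix m (piLen m x)).count m = x := by
  rw [count_gPrefix, piLen]
  exact Nat.count_nth_of_infinite hinf x

theorem RunModel.piLen_eq {m : ℕ} {c d v τ : ℕ → ℕ}
    (M : RunModel m c (fun i => gij m (i + 1)) d v τ)
    (hinf : {k : ℕ | curl (gPrefix m k) ≤ m}.Infinite) (x : ℕ) : piLen m x = d x := by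
  have h : piLen m = d := by
    refine ((Nat.nth_strictMono hinf).range_inj M.strictMono_d).1 ?_
    rw [Nat.range_nth_of_infinite hinf]
    ext k
    rw [Set.mem_ofPred_eq, curl_gPrefix_le_iff, M.w_eq_iff]
    simp [eq_comm]
  rw [h]

theorem phi_spec {m n : ℕ} (hocc : {p : ℕ | 1 ≤ p ∧ gij m p = n}.Nonempty) :
    ∃ p, phi m n = p + 1 ∧ gij m (p + 1) = n ∧ ∀ i < p, gij m (i + 1) ≠ n := by
  obtain ⟨h1, h2⟩ : 1 ≤ phi m n ∧ gij m (phi m n) = n := Nat.sInf_mem hocc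
  obtain ⟨p, hp⟩ := Nat.exists_eq_add_of_le' h1
  rw [hp] at h2
  refine ⟨p, hp, h2, fun i hi h => ?_⟩
  have : phi m n ≤ i + 1 := Nat.sInf_le ⟨by omega, h⟩
  omega

theorem phi_eq_of {m n p : ℕ} (hp : gij m (p + 1) = n) (hlt : ∀ i < p, gij m (i + 1) ≠ n) :
    phi m n = p + 1 := by
  obtain ⟨p', h1, h2, h3⟩ := phi_spec ⟨p + 1, by omega, hp⟩
  rcases lt_trichotomy p p' with h | rfl | h
  · exact absurd hp (h3 p h)
  · exact h1
  · exact absurd h2 (hlt p' h)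

/-- A prefix whose last letter occurs nowhere else in it has curling number one. -/
theorem curl_gPrefix_eq_one {m n p : ℕ} (hp : gij m (p + 1) = n)
    (hlt : ∀ i < p, gij m (i + 1) ≠ n) : curl (gPrefix m (p + 1)) = 1 := by
  rw [curl_gPrefix]
  refine le_antisymm ?_ (one_le_seqCurl _ _)
  by_contra! h
  obtain ⟨l, hl, hle, hper⟩ := (le_seqCurl_iff le_rfl).1 (Nat.succ_le_of_lt h)
  have := hper (p - l) (by omega) (by omega)
  rw [Nat.sub_add_cancel (by omega)] at this
  exact hlt (p - l) (by omega) (this.trans hp)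

theorem curl_gPrefix_phi {m n : ℕ} (hocc : {p : ℕ | 1 ≤ p ∧ gij m p = n}.Nonempty) :
    curl (gPrefix m (phi m n)) = 1 := by
  obtain ⟨p, h1, h2, h3⟩ := phi_spec hocc
  rw [h1]
  exact curl_gPrefix_eq_one h2 h3

/-- The first occurrence of `n` at level `m` ends a block, and the corresponding prefix of the
level-`(m+1)` sequence ends in the first occurrence of `n` there. -/
theorem exists_phi_eq_piLen (hSH : StandingHyp) {m n : ℕ} (hm : 1 ≤ m)
    (hocc : {p : ℕ | 1 ≤ p ∧ gij m p = n}.Nonempty) :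
    ∃ u, phi m n = piLen m ((m + 1) ^ u) ∧ (m + 1 ≤ n → tau m (u + 1) = phi (m + 1) n) := by
  obtain ⟨d, v, M⟩ := exists_runModel hSH hm
  have hpi := M.piLen_eq (hSH m hm).1
  have htau : ∀ u, tau m (u + 1) = Nat.nth (fun k => curl (gPrefix (m + 1) k) ≤ m) u :=
    fun _ => rfl
  set τ := Nat.nth fun k => curl (gPrefix (m + 1) k) ≤ m
  obtain ⟨p, hp, hpn, hlt⟩ := phi_spec hocc
  obtain ⟨x, s, rfl, hs⟩ := M.exists_run p
  have hend : ∃ y, d x + s + 1 = d y := by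
    have h1 := curl_gPrefix_phi hocc
    rw [hp] at h1
    exact (M.w_eq_iff _).1 ((curl_gPrefix_le_iff _ _).1 (by omega))
  have hd := M.d_succ x
  have hend : d x + s + 1 = d (x + 1) := by
    obtain ⟨y, hy⟩ := hend
    have h1 : x < y := M.strictMono_d.lt_iff_lt.1 (by omega)
    have h2 := M.strictMono_d.monotone (show x + 1 ≤ y from h1)
    omega
  have hsτ : s = τ (v (x + 1)) := by omega
  obtain ⟨u, hu⟩ : ∃ u, v (x + 1) = u := ⟨_, rfl⟩
  have hdvd : (m + 1) ^ u ∣ x + 1 := (M.pow_dvd _ (by omega) _).2 hu.ge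
  have hle := Nat.le_of_dvd (by omega) hdvd
  rw [hu] at hsτ
  obtain _ | r := s
  · have hx : x = 0 := by
      by_contra hx
      have h1 := M.strictMono_d (Nat.pos_of_ne_zero hx)
      exact hlt (d 0) (by omega) ((M.w_start 0).trans ((M.w_start x).symm.trans hpn))
    refine ⟨0, ?_, fun h => ?_⟩
    · rw [hpi, hp, hend, hx]; rfl
    · have := M.w_start x
      simp only [Nat.add_zero] at hpn
      omega
  have hru := M.w_run x r (by rw [hu]; omega)
  rw [show d x + 1 + r + 1 = d x + (r + 1) + 1 by ring, hpn] at hru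
  refine ⟨u, ?_, fun _ => ?_⟩
  · rw [hpi, hp, hend]
    congr 1
    refine (hle.lt_or_eq.resolve_left fun hlt' => ?_).symm
    obtain ⟨y, hy⟩ : ∃ y, (m + 1) ^ u = y + 1 :=
      ⟨(m + 1) ^ u - 1, by have : 0 < (m + 1) ^ u := by positivity
                           omega⟩
    have h1 : v (y + 1) = u := by rw [← hy, M.v_pow]
    have h2 := M.w_run y r (by rw [h1]; omega)
    have h3 := M.strictMono_d (show y < x by omega)
    exact hlt (d y + 1 + r) (by omega) (h2.trans hru.symm)
  · rw [htau, ← hsτ]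
    refine (phi_eq_of hru.symm fun i hi h => ?_).symm
    have h2 := M.w_run x i (by rw [hu]; omega)
    exact hlt (d x + 1 + i) (by omega) (h2.trans h)

theorem tfun_eq_of {m n u : ℕ} (hm : 1 ≤ m)
    (hinf : {k : ℕ | curl (gPrefix m k) ≤ m}.Infinite) (h : phi m n = piLen m ((m + 1) ^ u)) :
    tfun m n = u + 1 := by
  rw [tfun, h, count_piLen hinf, Nat.log_pow (by omega), add_comm]

/-- Lemma `phi t`. For `n ≥ m ≥ 1`: (1) there is a unique `t ≥ 1` with
`φ^(m)(n) = β^(m)(t)`; equivalently `C(A^(m)[1,φ^(m)(n)]) ≤ m` and the number of `m`'s in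
that prefix is `(m+1)^(t-1)` for exactly one `t ≥ 1`.  (2) If `n ≥ m+1`, then
`T_{t^(m)(n)}^(m) = B_{t^(m+1)(n)}^(m+1)`, in particular
`τ^(m)(t^(m)(n)) = β^(m+1)(t^(m+1)(n))`. -/
theorem statement0 (hSH : StandingHyp) (m n : ℕ) (hm : 1 ≤ m) (hmn : m ≤ n)
    (hocc : {p : ℕ | 1 ≤ p ∧ gij m p = n}.Nonempty)
    (hocc' : m + 1 ≤ n → {p : ℕ | 1 ≤ p ∧ gij (m + 1) p = n}.Nonempty) :
    curl (gPrefix m (phi m n)) ≤ m ∧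
    (∃! t : ℕ, 1 ≤ t ∧ phi m n = beta m t) ∧
    (∃! t : ℕ, 1 ≤ t ∧ (gPrefix m (phi m n)).count m = (m + 1) ^ (t - 1)) ∧
    (m + 1 ≤ n →
      Tstr m (tfun m n) = Bstr (m + 1) (tfun (m + 1) n) ∧
      tau m (tfun m n) = beta (m + 1) (tfun (m + 1) n)) := by
  have hinf := (hSH m hm).1
  obtain ⟨u, hu, hτ⟩ := exists_phi_eq_piLen hSH hm hocc
  refine ⟨(curl_gPrefix_phi hocc).trans_le hm, ⟨u + 1, ⟨by omega, hu⟩, ?_⟩,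
    ⟨u + 1, ⟨by omega, by rw [hu, count_piLen hinf]; rfl⟩, ?_⟩, fun hn => ?_⟩
  · rintro t ⟨ht, h⟩
    have h1 := (Nat.nth_strictMono hinf).injective (hu.symm.trans h)
    have := Nat.pow_right_injective (show 2 ≤ m + 1 by omega) h1
    omega
  · rintro t ⟨ht, h⟩
    rw [hu, count_piLen hinf] at h
    have := Nat.pow_right_injective (show 2 ≤ m + 1 by omega) h
    omega
  · obtain ⟨u', hu', -⟩ := exists_phi_eq_piLen hSH (Nat.le_add_left 1 m) (hocc' hn)
    have h : tau m (tfun m n) = beta (m + 1) (tfun (m + 1) n) := by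
      rw [tfun_eq_of hm hinf hu, tfun_eq_of (by omega) (hSH (m + 1) (by omega)).1 hu', hτ hn, hu']
      rfl
    exact ⟨by rw [Tstr, h]; rfl, h⟩
end

section
/- Let n ≥ 1 and x ≥ 1, and suppose π^(n)(1,x) = Q·X·X where X is a string containing the element n. Then at least one of the following holds: (1) there are integers t ≥ 1 and μ with 1 ≤ μ ≤ ⌊(n+1)/2⌋ such that X is a conjugate of (B_t^(n))^μ; (2) there are integers t ≥ 2, u > t, μ with 1 ≤ μ ≤ n, and ρ ≥ 1 with n+1 not dividing ρ, together with a nonempty suffix S of T_t^(n) satisfying T_t^(n)·S = T_u^(n), such that x = ρ·(n+1)^{u−1} + μ·(n+1)^{t−1} and Q·S = π^(n)(1, ρ·(n+1)^{u−1} − μ·(n+1)^{t−1}). -/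
open List Filter

open scoped Classical

namespace Gijswijt

/-! ### Arithmetic of the ruler sequence -/

section Ruler

variable {b : ℕ} {v : ℕ → ℕ}

/-- `v` is the exponent of the largest power of `b` dividing its (positive) argument. -/
def IsVal (b : ℕ) (v : ℕ → ℕ) : Prop := ∀ j, 0 < j → ∀ e, b ^ e ∣ j ↔ e ≤ v j

theorem isVal_multiplicity (hb : 2 ≤ b) : IsVal b (fun j => multiplicity b j) := by
  intro j hj e
  apply FiniteMultiplicity.pow_dvd_iff_le_multiplicity
  rw [Nat.finiteMultiplicity_iff]
  omega

theorem exists_dvd_mem_Ioc {d a l : ℕ} (hd : 0 < d) (hl : d ≤ l) :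
    ∃ j, d ∣ j ∧ a < j ∧ j ≤ a + l := by
  refine ⟨d * (a / d + 1), ⟨_, rfl⟩, Nat.lt_mul_div_succ a hd, ?_⟩
  have := Nat.mul_div_le a d
  rw [mul_add]
  omega

theorem IsVal.dvd_of_eq (hv : IsVal b v) {j c e : ℕ} (hj : c < j) (h : v j = v (j - c))
    (he : b ^ e ∣ j) : b ^ e ∣ c := by
  have h1 : b ^ e ∣ j - c := by
    rw [hv _ (by omega), ← h, ← hv _ (by omega)]
    exact he
  have := Nat.dvd_sub he h1
  rwa [show j - (j - c) = c by omega] at this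

/-- A window of the ruler sequence with period `c`, running over `k ≥ 2` full periods. -/
theorem IsVal.exists_of_periodic (hb : 2 ≤ b) (hv : IsVal b v) {x c k : ℕ} (hc : 1 ≤ c)
    (hk : 2 ≤ k) (hkc : k * c ≤ x)
    (hper : ∀ j, x + c < j + k * c → j ≤ x → v j = v (j - c)) :
    ∃ s μ, c = μ * b ^ s ∧ 1 ≤ μ ∧ k * μ < b ∧
      ∀ j, x < j + k * c → j ≤ x → ¬ b ^ (s + 1) ∣ j := by
  have h2c : 2 * c ≤ k * c := Nat.mul_le_mul_right c hk
  set s := Nat.log b c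
  have hsc : b ^ s ≤ c := Nat.pow_log_le_self b (by omega)
  have hcs : c < b ^ (s + 1) := Nat.lt_pow_succ_log_self (by omega) c
  have hbs : 0 < b ^ s := by positivity
  have hdvd : b ^ s ∣ c := by
    obtain ⟨j, hj, h1, h2⟩ := exists_dvd_mem_Ioc (a := x - c) hbs hsc
    exact hv.dvd_of_eq (by omega) (hper j (by omega) (by omega)) hj
  have hno : ∀ i, i < k → ∀ j, x < j + (i + 1) * c → j + i * c ≤ x → ¬ b ^ (s + 1) ∣ j := by
    intro i
    induction i with
    | zero =>
      intro _ j h1 h2 h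
      have := Nat.le_of_dvd (by omega)
        (hv.dvd_of_eq (by omega) (hper j (by omega) (by omega)) h)
      omega
    | succ i ih =>
      intro hi j h1 h2 h
      have hik : (i + 2) * c ≤ k * c := Nat.mul_le_mul_right c hi
      have e1 : (i + 1) * c = i * c + c := by ring
      have e2 : (i + 1 + 1) * c = i * c + c + c := by ring
      have e3 : (i + 2) * c = i * c + c + c := by ring
      refine ih (by omega) (j + c) (by omega) (by omega) ?_
      have hp := hper (j + c) (by omega) (by omega)
      rw [Nat.add_sub_cancel] at hp
      rw [hv _ (by omega), hp, ← hv _ (by omega)]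
      exact h
  have hall : ∀ j, x < j + k * c → j ≤ x → ¬ b ^ (s + 1) ∣ j := by
    intro j h1 h2
    have e := Nat.div_add_mod (x - j) c
    have hm := Nat.mod_lt (x - j) (by omega : c > 0)
    have e' : c * ((x - j) / c) = (x - j) / c * c := mul_comm _ _
    have e'' : ((x - j) / c + 1) * c = (x - j) / c * c + c := by ring
    refine hno ((x - j) / c) ?_ j (by omega) (by omega)
    rw [Nat.div_lt_iff_lt_mul (by omega)]
    omega
  obtain ⟨μ, hμ⟩ := hdvd
  have hμ' : c = μ * b ^ s := by rw [hμ, mul_comm]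
  refine ⟨s, μ, hμ', ?_, ?_, hall⟩
  · rcases Nat.eq_zero_or_pos μ with h | h
    · simp [h] at hμ'
      omega
    · exact h
  · by_contra hcon
    have : b ^ (s + 1) ≤ k * c := by
      rw [hμ', pow_succ, mul_comm, ← mul_assoc]
      exact Nat.mul_le_mul_right _ (by omega)
    obtain ⟨j, hj, h1, h2⟩ := exists_dvd_mem_Ioc (a := x - k * c) (by positivity) this
    exact hall j (by omega) (by omega) hj

theorem IsVal.le_of_periodic (hb : 2 ≤ b) (hv : IsVal b v) {x c k : ℕ} (hc : 1 ≤ c)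
    (hkc : k * c ≤ x)
    (hper : ∀ j, x + c < j + k * c → j < x → v j = v (j - c)) : k ≤ b := by
  by_cases hk : k ≤ 2
  · omega
  obtain ⟨k, rfl⟩ : ∃ k', k = k' + 1 := ⟨k - 1, by omega⟩
  have e : (k + 1) * c = k * c + c := by ring
  obtain ⟨s, μ, -, h1, h2, -⟩ := hv.exists_of_periodic hb (x := x - c) (k := k) hc (by omega)
    (by omega) (fun j h1 h2 => hper j (by omega) (by omega))
  have := Nat.mul_le_mul_left k h1
  omega

theorem IsVal.of_lt (hb : 2 ≤ b) (hv : IsVal b v) {x c k : ℕ} (hc : 1 ≤ c)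
    (hk : 2 ≤ k) (hkc : k * c ≤ x)
    (hper : ∀ j, x + c < j + k * c → j < x → v j = v (j - c)) (hlt : v x < v (x - c)) :
    k = 2 ∧ b ^ v x ∣ c ∧ c < b ^ (v x + 1) ∧ 2 * c < x ∧ v (x - 2 * c) = v x := by
  have h2c : 2 * c ≤ k * c := Nat.mul_le_mul_right c hk
  have hx1 : b ^ (v x + 1) ∣ x - c := by
    rw [hv _ (by omega)]
    omega
  have hx0 : ¬ b ^ (v x + 1) ∣ x := by
    rw [hv _ (by omega)]
    omega
  have hc1 : ¬ b ^ (v x + 1) ∣ c := by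
    intro h
    have := Nat.dvd_add hx1 h
    rw [Nat.sub_add_cancel (by omega)] at this
    exact hx0 this
  have hxx : b ^ v x ∣ x := by rw [hv _ (by omega)]
  have hx1' : b ^ v x ∣ x - c := (pow_dvd_pow b (Nat.le_succ _)).trans hx1
  have hc0 : b ^ v x ∣ c := by
    have := Nat.dvd_sub hxx hx1'
    rwa [show x - (x - c) = c by omega] at this
  have hne : 2 * c < x := by
    by_contra h
    apply hc1
    rwa [show x - c = c by omega] at hx1
  have hk2 : k = 2 := by
    by_contra h
    have h3c : 3 * c ≤ k * c := Nat.mul_le_mul_right c (by omega)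
    exact hc1 (hv.dvd_of_eq (by omega) (hper (x - c) (by omega) (by omega)) hx1)
  refine ⟨hk2, hc0, ?_, hne, ?_⟩
  · by_contra h
    have hcne : c ≠ b ^ (v x + 1) := by
      intro h
      exact hc1 (by rw [← h])
    obtain ⟨j, hj, h1, h2⟩ := exists_dvd_mem_Ioc (a := x - c) (d := b ^ (v x + 1)) (l := c - 1)
      (by positivity) (by omega)
    exact hc1 (hv.dvd_of_eq (by omega) (hper j (by omega) (by omega)) hj)
  · have e : x - 2 * c = x - c - c := by omega
    apply le_antisymm
    · by_contra h
      have h1 : b ^ (v x + 1) ∣ x - 2 * c := by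
        rw [hv _ (by omega)]
        omega
      have := Nat.dvd_sub hx1 h1
      rw [show x - c - (x - 2 * c) = c by omega] at this
      exact hc1 this
    · rw [← hv _ (by omega), e]
      exact Nat.dvd_sub hx1' hc0

theorem IsVal.min_add (hv : IsVal b v) {e j : ℕ} (hj : 0 < j) {d : ℕ} (hd : b ^ e ∣ d) :
    min (v (j + d)) e = min (v j) e := by
  have key : ∀ f, f ≤ e → (f ≤ v (j + d) ↔ f ≤ v j) := by
    intro f hf
    rw [← hv _ hj, ← hv _ (by omega)]
    exact (Nat.dvd_add_left ((pow_dvd_pow b hf).trans hd))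
  apply le_antisymm
  · exact le_min ((key _ (min_le_right _ _)).1 (min_le_left _ _)) (min_le_right _ _)
  · exact le_min ((key _ (min_le_right _ _)).2 (min_le_left _ _)) (min_le_right _ _)

end Ruler

/-! ### Words cut into blocks `m :: g i` -/

section Blocks

variable {m : ℕ} {g : ℕ → List ℕ}

/-- The concatenation of the blocks `m :: g i` for `a < i ≤ a + l`. -/
def seg (m : ℕ) (g : ℕ → List ℕ) (a : ℕ) : ℕ → List ℕ
  | 0 => []
  | l + 1 => seg m g a l ++ m :: g (a + l + 1)

theorem seg_add (a l l' : ℕ) : seg m g a (l + l') = seg m g a l ++ seg m g (a + l) l' := by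
  induction l' with
  | zero => simp [seg]
  | succ l' ih =>
    rw [← add_assoc, seg, ih, seg, List.append_assoc]
    simp [add_assoc]

theorem seg_congr {h : ℕ → List ℕ} {a a' l : ℕ}
    (H : ∀ i, i < l → g (a + i + 1) = h (a' + i + 1)) : seg m g a l = seg m h a' l := by
  induction l with
  | zero => rfl
  | succ l ih => rw [seg, seg, ih (fun i hi => H i (by omega)), H l (by omega)]

theorem count_seg (hg : ∀ i, m ∉ g i) (a l : ℕ) : (seg m g a l).count m = l := by
  induction l with
  | zero => rfl
  | succ l ih => simp [seg, ih, List.count_eq_zero_of_not_mem (hg _)]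

theorem suffix_of_append_eq {A P B G : List ℕ} (hP : m ∉ P) (h : A ++ P = B ++ m :: G) :
    P <:+ G := by
  rcases List.append_eq_append_iff.1 h with ⟨C, -, h2⟩ | ⟨C, -, h2⟩
  · exact absurd (by rw [h2]; simp) hP
  · rcases C with _ | ⟨d, C⟩
    · simp at h2
      exact absurd (by rw [← h2]; simp) hP
    · simp at h2
      exact ⟨C, h2.2.symm⟩

theorem append_cons_inj {A A' R R' : List ℕ} (hR : m ∉ R) (hR' : m ∉ R')
    (h : A ++ m :: R = A' ++ m :: R') : A = A' ∧ R = R' := by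
  have h1 : R <:+ R' := suffix_of_append_eq (A := A ++ [m]) hR (by simpa using h)
  have h2 : R' <:+ R := suffix_of_append_eq (A := A' ++ [m]) hR' (by simpa using h.symm)
  have : R = R' := h1.eq_of_length (le_antisymm h1.length_le h2.length_le)
  subst this
  simpa using h

theorem eq_seg_of_append_cons (hg : ∀ i, m ∉ g i) {x : ℕ} {A Z R : List ℕ} (hR : m ∉ R)
    (h : A ++ m :: Z = seg m g 0 x ++ m :: R) : ∃ i, i ≤ x ∧ A = seg m g 0 i := by
  induction x generalizing Z R with
  | zero =>
    refine ⟨0, le_rfl, ?_⟩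
    rcases A with _ | ⟨a, A⟩
    · rfl
    · simp [seg] at h
      exact absurd (by rw [← h.2]; simp) hR
  | succ x ih =>
    by_cases hZ : m ∈ Z
    · obtain ⟨Z₁, Z₂, rfl, hZ₂⟩ : ∃ Z₁ Z₂, Z = Z₁ ++ m :: Z₂ ∧ m ∉ Z₂ := by
        obtain ⟨s, t, h1, h2⟩ := List.eq_append_cons_of_mem (List.mem_reverse.2 hZ)
        exact ⟨t.reverse, s.reverse, by simpa using congrArg List.reverse h1, by simpa using h2⟩
      have h' : (A ++ m :: Z₁) ++ m :: Z₂ = seg m g 0 (x + 1) ++ m :: R := by simpa using h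
      obtain ⟨i, hi, e⟩ := ih (hg _) (append_cons_inj hZ₂ hR h').1
      exact ⟨i, by omega, e⟩
    · exact ⟨x + 1, le_rfl, (append_cons_inj hZ hR h).1⟩

theorem seg_suffix_split (hg : ∀ i, m ∉ g i) {x : ℕ} {Q Y R : List ℕ} (hR : m ∉ R) (hY : m ∈ Y)
    (h : seg m g 0 x ++ m :: R = Q ++ Y) :
    Y.count m ≤ x + 1 ∧ 1 ≤ Y.count m ∧ ∃ P, m ∉ P ∧ Q ++ P = seg m g 0 (x + 1 - Y.count m) ∧
      Y = P ++ seg m g (x + 1 - Y.count m) (Y.count m - 1) ++ m :: R := by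
  obtain ⟨P, Z, rfl, hP⟩ := List.eq_append_cons_of_mem hY
  obtain ⟨i, hi, e⟩ := eq_seg_of_append_cons hg hR
    (show (Q ++ P) ++ m :: Z = seg m g 0 x ++ m :: R by simp [h])
  have hx : x = i + (x - i) := by omega
  have e2 : m :: Z = seg m g i (x - i) ++ m :: R := by
    rw [hx, seg_add, ← List.append_assoc, ← e] at h
    simpa using h.symm
  have hc : (P ++ m :: Z).count m = x - i + 1 := by
    rw [e2]
    simp [count_seg hg, List.count_eq_zero_of_not_mem hP, List.count_eq_zero_of_not_mem hR]
  rw [hc]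
  refine ⟨by omega, by omega, P, hP, ?_, ?_⟩
  · rw [e]
    congr 1
    omega
  · rw [show x + 1 - (x - i + 1) = i by omega, Nat.add_sub_cancel, e2, List.append_assoc]

theorem seg_append_inj (hg : ∀ i, m ∉ g i) {n a a' : ℕ} {P P' R R' : List ℕ}
    (hR : m ∉ R) (hR' : m ∉ R')
    (h : P ++ seg m g a n ++ m :: R = P' ++ seg m g a' n ++ m :: R') :
    P = P' ∧ R = R' ∧ ∀ i, i < n → g (a + i + 1) = g (a' + i + 1) := by
  induction n generalizing R R' with
  | zero => simpa [seg] using append_cons_inj hR hR' h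
  | succ n ih =>
    obtain ⟨h1, h2⟩ := append_cons_inj hR hR' h
    obtain ⟨h3, h4, h5⟩ := ih (hg _) (hg _) (by simpa [seg] using h1)
    refine ⟨h3, h2, fun i hi => ?_⟩
    rcases Nat.lt_succ_iff_lt_or_eq.1 hi with h | rfl
    · exact h5 i h
    · exact h4

/-- A power at the end of a block word forces the gap sequence to be periodic. -/
theorem exists_of_power_suffix (hg : ∀ i, m ∉ g i) {x k : ℕ} {Q Y R : List ℕ} (hR : m ∉ R)
    (hY : m ∈ Y) (hk : 2 ≤ k)
    (h : seg m g 0 x ++ m :: R = Q ++ (List.replicate k Y).flatten) :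
    1 ≤ Y.count m ∧ k * Y.count m ≤ x + 1 ∧
      (∀ j, x + 1 + Y.count m < j + k * Y.count m → j < x + 1 → g j = g (j - Y.count m)) ∧
      ∃ P, m ∉ P ∧ g (x + 1 - Y.count m) = R ++ P ∧
        Q ++ P = seg m g 0 (x + 1 - k * Y.count m) ∧
        Y = P ++ seg m g (x + 1 - Y.count m) (Y.count m - 1) ++ m :: R := by
  induction k, hk using Nat.le_induction generalizing x R Q with
  | base =>
    obtain ⟨h1, h2, P, hP, h3, h4⟩ := seg_suffix_split hg hR hY
      (show seg m g 0 x ++ m :: R = (Q ++ Y) ++ Y by simp [h])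
    set c := Y.count m with hc
    have hpos : x + 1 - c ≠ 0 := by
      intro h0
      rw [h0] at h3
      have : m ∈ Q ++ Y ++ P := by simp [hY]
      rw [h3] at this
      simp [seg] at this
    obtain ⟨y, hy⟩ := Nat.exists_eq_succ_of_ne_zero hpos
    have hcYP : (Y ++ P).count m = c := by
      simp [hc, List.count_eq_zero_of_not_mem hP]
    obtain ⟨h5, -, P', hP', h6, h7⟩ := seg_suffix_split hg (hg _)
      (show m ∈ Y ++ P by simp [hY])
      (show seg m g 0 y ++ m :: g (0 + y + 1) = Q ++ (Y ++ P) by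
        rw [← List.append_assoc, h3, hy]; rfl)
    rw [hcYP] at h5 h6 h7
    have hRP : m ∉ R ++ P := by simp [hR, hP]
    obtain ⟨e1, e2, e3⟩ := seg_append_inj hg hRP (hg _)
      (show P ++ seg m g (x + 1 - c) (c - 1) ++ m :: (R ++ P)
        = P' ++ seg m g (y + 1 - c) (c - 1) ++ m :: g (0 + y + 1) by
        rw [← h7]; conv_rhs => rw [h4]
        simp)
    refine ⟨h2, by omega, fun j hj hj' => ?_, P, hP, ?_, ?_, h4⟩
    · have := e3 (j - (x + 1 - c) - 1) (by omega)
      rw [show x + 1 - c + (j - (x + 1 - c) - 1) + 1 = j by omega,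
        show y + 1 - c + (j - (x + 1 - c) - 1) + 1 = j - c by omega] at this
      exact this
    · rw [e2]
      congr 1
      omega
    · rw [e1, h6]
      congr 1
      omega
  | succ k hk ih =>
    obtain ⟨h1, h2, h3, P, hP, h4, h5, h6⟩ := ih hR
      (show seg m g 0 x ++ m :: R = (Q ++ Y) ++ (List.replicate k Y).flatten by
        rw [h, List.replicate_succ]; simp)
    have hQ : seg m g 0 x ++ m :: R = (Q ++ (List.replicate k Y).flatten) ++ Y := by
      rw [h, List.replicate_succ']
      simp
    obtain ⟨h1', h2', P', hP', h3', h4'⟩ := seg_suffix_split hg hR hY hQ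
    set c := Y.count m
    have hkc : 2 * c ≤ k * c := Nat.mul_le_mul_right c hk
    obtain ⟨e1, -, -⟩ := seg_append_inj hg hR hR (h6.symm.trans h4')
    have hx : seg m g 0 (x - c) ++ m :: R = Q ++ (List.replicate k Y).flatten := by
      have a1 : seg m g 0 x = seg m g 0 (x + 1 - c) ++ seg m g (x + 1 - c) (c - 1) := by
        conv_lhs => rw [show x = (x + 1 - c) + (c - 1) by omega, seg_add]
        simp
      have a2 : seg m g 0 (x + 1 - c) = seg m g 0 (x - c) ++ m :: g (x + 1 - c) := by
        rw [show x + 1 - c = (x - c) + 1 by omega, seg]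
        simp
      rw [h4, ← h3', e1] at a2
      have a3 := List.append_cancel_right (show (Q ++ (List.replicate k Y).flatten) ++ P'
        = (seg m g 0 (x - c) ++ m :: R) ++ P' by simp [a2])
      exact a3.symm
    obtain ⟨-, i2, i3, P'', hP'', i4, i5, i6⟩ := ih hR hx
    obtain ⟨e2, -, -⟩ : P = P'' ∧ R = R ∧ ∀ i, i < c - 1 → _ :=
      seg_append_inj hg hR hR (h6.symm.trans i6)
    subst e2
    have ek : (k + 1) * c = k * c + c := by ring
    refine ⟨h1, by omega, fun j hj hj' => ?_, P, hP, h4, ?_, h6⟩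
    · rcases lt_trichotomy j (x + 1 - c) with hlt | heq | hgt
      · exact i3 j (by omega) (by omega)
      · rw [heq, h4, ← i4]
        congr 1
        omega
      · exact h3 j (by omega) hj'
    · rw [i5]
      congr 1
      omega

theorem seg_add_mul_of_periodic {c : ℕ} (a k l : ℕ) (hper : ∀ j, 0 < j → g (j + c) = g j) :
    seg m g (a + k * c) l = seg m g a l := by
  refine seg_congr fun i _ => ?_
  induction k with
  | zero => simp
  | succ k ih =>
    rw [← ih, ← hper (a + k * c + i + 1) (by omega)]
    congr 1
    ring

/-- A block word over full periods is a power. -/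
theorem seg_mul_of_periodic {c : ℕ} (a k : ℕ) (hper : ∀ j, 0 < j → g (j + c) = g j) :
    seg m g a (k * c) = (List.replicate k (seg m g a c)).flatten := by
  induction k with
  | zero => simp [seg]
  | succ k ih =>
    rw [add_mul, one_mul, seg_add, ih, seg_add_mul_of_periodic a k c hper, List.replicate_succ']
    simp

/-- A block word over full periods is a conjugate of the one starting at the origin. -/
theorem exists_conj_of_periodic {c : ℕ} (a k : ℕ) (hc : 0 < c) (hk : 1 ≤ k)
    (hper : ∀ j, 0 < j → g (j + c) = g j) :
    ∃ U V : List ℕ, seg m g 0 (k * c) = U ++ V ∧ seg m g a (k * c) = V ++ U := by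
  have hr : a % c < c := Nat.mod_lt a hc
  have hck : c ≤ k * c := Nat.le_mul_of_pos_left c hk
  refine ⟨seg m g 0 (a % c), seg m g (a % c) (k * c - a % c), ?_, ?_⟩
  · have := seg_add (m := m) (g := g) 0 (a % c) (k * c - a % c)
    rwa [zero_add, Nat.add_sub_cancel' (by omega)] at this
  · have e : a = a % c + a / c * c := by rw [mul_comm, Nat.mod_add_div]
    have e2 : k * c = (k * c - a % c) + a % c := by omega
    conv_lhs => rw [e, seg_add_mul_of_periodic _ _ _ hper, e2, seg_add,
      show a % c + (k * c - a % c) = 0 + k * c by omega, seg_add_mul_of_periodic _ _ _ hper]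

end Blocks

/-! ### Curling numbers -/

section Curl

theorem curl_set_bddAbove (S : List ℕ) :
    BddAbove {k | ∃ X Y : List ℕ, Y ≠ [] ∧ S = X ++ (List.replicate k Y).flatten} := by
  refine ⟨S.length, ?_⟩
  rintro k ⟨X, Y, hY, rfl⟩
  have := List.length_pos_iff.2 hY
  simp
  nlinarith

theorem one_le_curl (S : List ℕ) : 1 ≤ curl S := le_max_left _ _

theorem le_curl {k : ℕ} {X Y : List ℕ} (hY : Y ≠ []) :
    k ≤ curl (X ++ (List.replicate k Y).flatten) :=
  (le_csSup (curl_set_bddAbove _) ⟨X, Y, hY, rfl⟩).trans (le_max_right _ _)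

theorem exists_eq_append_of_two_le_curl {S : List ℕ} (h : 2 ≤ curl S) :
    ∃ X Y : List ℕ, Y ≠ [] ∧ S = X ++ (List.replicate (curl S) Y).flatten := by
  have hne : {k | ∃ X Y : List ℕ, Y ≠ [] ∧ S = X ++ (List.replicate k Y).flatten}.Nonempty :=
    ⟨0, S, [0], by simp, by simp⟩
  have := Nat.sSup_mem hne (curl_set_bddAbove S)
  have e : curl S
      = sSup {k | ∃ X Y : List ℕ, Y ≠ [] ∧ S = X ++ (List.replicate k Y).flatten} := by
    unfold curl at h ⊢
    omega
  rw [e]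
  exact this

theorem curl_le_append (A S : List ℕ) : curl S ≤ curl (A ++ S) := by
  by_cases h : 2 ≤ curl S
  · obtain ⟨X, Y, hY, e⟩ := exists_eq_append_of_two_le_curl h
    generalize curl S = k at *
    rw [e, ← List.append_assoc]
    exact le_curl hY
  · have := one_le_curl (A ++ S)
    omega

theorem curl_le_append_cons (A : List ℕ) (a : ℕ) (S : List ℕ) :
    curl S ≤ curl (A ++ a :: S) := by
  simpa using curl_le_append (A ++ [a]) S

theorem curl_nil : curl [] = 1 := by
  refine le_antisymm ?_ (one_le_curl _)
  by_contra h
  obtain ⟨X, Y, hY, e⟩ := exists_eq_append_of_two_le_curl (S := []) (by omega)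
  generalize curl [] = k at *
  obtain ⟨k, rfl⟩ := Nat.exists_eq_succ_of_ne_zero (show k ≠ 0 by omega)
  simp [List.replicate_succ, hY] at e

end Curl

/-! ### The block structure of the Gijswijt sequences -/

section Structure

variable {m : ℕ}

theorem length_gPrefix (m k : ℕ) : (gPrefix m k).length = k := by
  induction k with
  | zero => rfl
  | succ k ih => simp [gPrefix, ih]

theorem le_of_mem_gPrefix {k a : ℕ} (h : a ∈ gPrefix m k) : m ≤ a := by
  induction k with
  | zero => simp [gPrefix] at h
  | succ k ih =>
    simp only [gPrefix, List.mem_append, List.mem_singleton] at h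
    rcases h with h | rfl
    · exact ih h
    · exact le_max_left _ _

theorem not_mem_gPrefix_succ (m k : ℕ) : m ∉ gPrefix (m + 1) k := fun h => by
  have := le_of_mem_gPrefix h
  omega

theorem nth_succ_eq {p : ℕ → Prop} (hp : {k | p k}.Infinite) {x L : ℕ} (hL : p L)
    (hlt : Nat.nth p x < L) (hno : ∀ j, Nat.nth p x < j → j < L → ¬ p j) :
    Nat.nth p (x + 1) = L := by
  have h1 : Nat.nth p x < Nat.nth p (x + 1) := Nat.nth_strictMono hp (Nat.lt_succ_self x)
  apply le_antisymm
  · by_contra h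
    have h2 := Nat.nth_count hL
    have h3 : x < Nat.count p L := by
      rw [← (Nat.nth_strictMono hp).lt_iff_lt, h2]
      exact hlt
    exact h (((Nat.nth_strictMono hp).monotone (show x + 1 ≤ Nat.count p L from h3)).trans h2.le)
  · by_contra h
    exact hno _ h1 (by omega) (Nat.nth_mem_of_infinite hp _)

/-- The string following the `i`-th occurrence of `m` in the level-`m` sequence. -/
noncomputable def gap (m i : ℕ) : List ℕ := Tstr m (multiplicity (m + 1) i + 1)

theorem Tstr_succ (m e : ℕ) :
    Tstr m (e + 1) = gPrefix (m + 1) (Nat.nth (fun k => curl (gPrefix (m + 1) k) ≤ m) e) := rfl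

theorem not_mem_Tstr (m t : ℕ) : m ∉ Tstr m t := not_mem_gPrefix_succ m _

theorem not_mem_gap (m i : ℕ) : m ∉ gap m i := not_mem_gPrefix_succ m _

theorem isVal (hm : 1 ≤ m) : IsVal (m + 1) (fun j => multiplicity (m + 1) j) :=
  isVal_multiplicity (by omega)

theorem length_Tstr_strictMono (hT : {k : ℕ | curl (gPrefix (m + 1) k) ≤ m}.Infinite) :
    StrictMono fun e => (Tstr m (e + 1)).length := by
  intro a b h
  simp only [Tstr_succ, length_gPrefix]
  exact Nat.nth_strictMono hT h

theorem Tstr_one (hm : 1 ≤ m) : Tstr m 1 = [] := by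
  have : Nat.nth (fun k => curl (gPrefix (m + 1) k) ≤ m) 0 = 0 :=
    Nat.nth_zero_of_zero (by simpa [gPrefix, curl_nil] using hm)
  rw [← zero_add 1, Tstr_succ, this]
  rfl

theorem curl_Tstr_succ_le (hT : {k : ℕ | curl (gPrefix (m + 1) k) ≤ m}.Infinite) (e : ℕ) :
    curl (Tstr m (e + 1)) ≤ m :=
  Nat.nth_mem_of_infinite hT e

theorem gap_inj (hT : {k : ℕ | curl (gPrefix (m + 1) k) ≤ m}.Infinite) {i j : ℕ}
    (h : gap m i = gap m j) : multiplicity (m + 1) i = multiplicity (m + 1) j :=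
  (length_Tstr_strictMono hT).injective (congrArg List.length h)

theorem le_of_gap_prefix (hT : {k : ℕ | curl (gPrefix (m + 1) k) ≤ m}.Infinite) {i j : ℕ}
    (h : gap m i <+: gap m j) : multiplicity (m + 1) i ≤ multiplicity (m + 1) j :=
  (length_Tstr_strictMono hT).le_iff_le.1 h.length_le

theorem suffix_gap {Q P : List ℕ} {x : ℕ} (hx : 0 < x) (hP : m ∉ P)
    (h : Q ++ P = seg m (gap m) 0 x) : P <:+ gap m x := by
  obtain ⟨y, rfl⟩ := Nat.exists_eq_succ_of_ne_zero hx.ne'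
  have := suffix_of_append_eq hP h
  rwa [zero_add] at this

theorem le_curl_of_not_mem {A R X Y : List ℕ} {k : ℕ} (hY : Y ≠ []) (hmY : m ∉ Y)
    (h : A ++ m :: R = X ++ (List.replicate k Y).flatten) : k ≤ curl R := by
  have hP : m ∉ (List.replicate k Y).flatten := by
    simp only [List.mem_flatten, List.mem_replicate, not_exists, not_and]
    rintro _ ⟨-, rfl⟩
    exact hmY
  obtain ⟨Z, rfl⟩ := suffix_of_append_eq hP h.symm
  exact le_curl hY

theorem curl_seg_append_le (hm : 1 ≤ m) (hT : {k : ℕ | curl (gPrefix (m + 1) k) ≤ m}.Infinite)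
    {x : ℕ} {R : List ℕ} (hR : m ∉ R) :
    curl (seg m (gap m) 0 x ++ m :: R) ≤ max (m + 1) (curl R) := by
  by_cases h2 : 2 ≤ curl (seg m (gap m) 0 x ++ m :: R)
  · obtain ⟨X, Y, hY, e⟩ := exists_eq_append_of_two_le_curl h2
    generalize curl (seg m (gap m) 0 x ++ m :: R) = k at *
    by_cases hmY : m ∈ Y
    · obtain ⟨h1, h3, h4, -⟩ := exists_of_power_suffix (not_mem_gap m) hR hmY h2 e
      exact le_max_of_le_left ((isVal hm).le_of_periodic (by omega) h1 h3
        fun j hj hj' => gap_inj hT (h4 j hj hj'))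
    · exact le_max_of_le_right (le_curl_of_not_mem hY hmY e)
  · omega

theorem curl_seg_le (hm : 1 ≤ m) (hT : {k : ℕ | curl (gPrefix (m + 1) k) ≤ m}.Infinite)
    (x : ℕ) : curl (seg m (gap m) 0 x ++ m :: gap m (x + 1)) ≤ m := by
  by_cases h2 : 2 ≤ curl (seg m (gap m) 0 x ++ m :: gap m (x + 1))
  · obtain ⟨X, Y, hY, e⟩ := exists_eq_append_of_two_le_curl h2
    generalize curl (seg m (gap m) 0 x ++ m :: gap m (x + 1)) = k at *
    by_cases hmY : m ∈ Y
    · obtain ⟨h1, h3, h4, P, hP, h5, h6, -⟩ :=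
        exists_of_power_suffix (not_mem_gap m) (not_mem_gap m _) hmY h2 e
      set c := Y.count m
      have hper : ∀ j, x + 1 + c < j + k * c → j < x + 1 →
        multiplicity (m + 1) j = multiplicity (m + 1) (j - c) :=
        fun j hj hj' => gap_inj hT (h4 j hj hj')
      rcases (le_of_gap_prefix hT ⟨P, h5.symm⟩).eq_or_lt with heq | hlt
      · obtain ⟨s, μ, -, h7, h8, -⟩ := (isVal hm).exists_of_periodic (by omega) h1 h2 h3
          fun j hj hj' => by
            rcases hj'.eq_or_lt with rfl | hj'
            · exact heq
            · exact hper j hj hj'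
        have := Nat.mul_le_mul_left k h7
        omega
      · obtain ⟨rfl, -, -, h7, h8⟩ := (isVal hm).of_lt (by omega) h1 h2 h3 hper hlt
        by_contra hlt2
        have hPs : P <:+ gap m (x + 1) := by
          have := suffix_gap (by omega) hP h6
          unfold gap at this ⊢
          rwa [h8] at this
        have hPne : P ≠ [] := by
          rintro rfl
          rw [List.append_nil] at h5
          exact hlt.ne (gap_inj hT h5).symm
        obtain ⟨Z, hZ⟩ := hPs
        have hc : curl (gap m (x + 1 - c)) ≤ m := curl_Tstr_succ_le hT _
        rw [h5, ← hZ] at hc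
        have := le_curl (k := 2) (X := Z) hPne
        simp only [List.replicate, List.flatten_cons, List.flatten_nil, List.append_nil,
          ← List.append_assoc] at this
        omega
    · exact (le_curl_of_not_mem hY hmY e).trans (curl_Tstr_succ_le hT _)
  · omega

/-- The gap sequence with valuations cut off at `e`. -/
noncomputable def cappedGap (m e j : ℕ) : List ℕ := Tstr m (min (multiplicity (m + 1) j) e + 1)

theorem cappedGap_add (hm : 1 ≤ m) (e j : ℕ) (hj : 0 < j) :
    cappedGap m e (j + (m + 1) ^ e) = cappedGap m e j := by
  unfold cappedGap
  rw [(isVal hm).min_add hj dvd_rfl]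

theorem cappedGap_eq (hm : 1 ≤ m) {e j : ℕ} (hj : 0 < j) (h : ¬ (m + 1) ^ (e + 1) ∣ j) :
    cappedGap m e j = gap m j := by
  rw [isVal hm _ hj, not_le, Nat.lt_succ_iff] at h
  rw [cappedGap, gap, min_eq_left h]

theorem lt_curl_seg_append (hm : 1 ≤ m) {x e : ℕ} (he : e < multiplicity (m + 1) (x + 1)) :
    m + 1 ≤ curl (seg m (gap m) 0 x ++ m :: Tstr m (e + 1)) := by
  have hd : (m + 1) ^ (e + 1) ∣ x + 1 := (isVal hm _ (by omega) _).2 he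
  have hle : (m + 1) ^ (e + 1) ≤ x + 1 := Nat.le_of_dvd (by omega) hd
  have hpos : 0 < (m + 1) ^ (e + 1) := by positivity
  obtain ⟨a, ha⟩ := Nat.exists_eq_add_of_le' hle
  obtain ⟨l, hl⟩ := Nat.exists_eq_succ_of_ne_zero hpos.ne'
  have hx : x = a + l := by omega
  have hX : cappedGap m e (a + l + 1) = Tstr m (e + 1) := by
    unfold cappedGap
    rw [← hx, min_eq_right (by omega)]
  have hseg : seg m (gap m) a l = seg m (cappedGap m e) a l := by
    refine seg_congr fun i hi => (cappedGap_eq hm (by omega) fun h => ?_).symm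
    have := Nat.le_of_dvd (by omega) (Nat.dvd_sub hd h)
    omega
  have key : seg m (gap m) 0 x ++ m :: Tstr m (e + 1)
      = seg m (gap m) 0 a ++ seg m (cappedGap m e) a ((m + 1) * (m + 1) ^ e) := by
    rw [← pow_succ', hl, seg, hX, hx, seg_add, zero_add, hseg, List.append_assoc]
  rw [key, seg_mul_of_periodic _ _ (cappedGap_add hm e)]
  refine le_curl fun h => ?_
  have := congrArg (List.count m) h
  rw [count_seg (g := cappedGap m e) fun _ => not_mem_Tstr m _] at this
  simp at this

/-- `seg m (gap m) 0 x` is a prefix of the level-`m` sequence, of the expected length. -/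
theorem piStr_eq_seg (hm : 1 ≤ m) (hA : {k : ℕ | curl (gPrefix m k) ≤ m}.Infinite)
    (hT : {k : ℕ | curl (gPrefix (m + 1) k) ≤ m}.Infinite) (x : ℕ) :
    piStr m x = seg m (gap m) 0 x := by
  induction x with
  | zero =>
    have : piLen m 0 = 0 := by
      exact Nat.nth_zero_of_zero (by simpa [gPrefix, curl_nil] using hm)
    rw [piStr, this]
    rfl
  | succ x ih =>
    set L := piLen m x with hL
    have hcL : curl (gPrefix m L) ≤ m := Nat.nth_mem_of_infinite hA x
    set N := Nat.nth (fun k => curl (gPrefix (m + 1) k) ≤ m) (multiplicity (m + 1) (x + 1))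
    have hgap : gap m (x + 1) = gPrefix (m + 1) N := rfl
    have hlt : ∀ r, r < N → m + 1 ≤ curl (seg m (gap m) 0 x ++ m :: gPrefix (m + 1) r) := by
      intro r hr
      by_cases hc : curl (gPrefix (m + 1) r) ≤ m
      · rw [← Nat.nth_count (p := fun k => curl (gPrefix (m + 1) k) ≤ m) hc] at hr ⊢
        exact lt_curl_seg_append hm ((Nat.nth_strictMono hT).lt_iff_lt.1 hr)
      · exact (not_le.1 hc).trans_le (curl_le_append_cons _ _ _)
    have hpre : ∀ r, r ≤ N →
        gPrefix m (L + 1 + r) = seg m (gap m) 0 x ++ m :: gPrefix (m + 1) r := by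
      intro r
      induction r with
      | zero =>
        intro _
        rw [← ih]
        simp [gPrefix, piStr, ← hL, hcL]
      | succ r ihr =>
        intro hr
        have h1 := hlt r (by omega)
        have h2 := curl_seg_append_le hm hT (x := x) (not_mem_gPrefix_succ m r)
        have h3 := curl_le_append_cons (seg m (gap m) 0 x) m (gPrefix (m + 1) r)
        have h4 : max m (curl (seg m (gap m) 0 x ++ m :: gPrefix (m + 1) r))
            = max (m + 1) (curl (gPrefix (m + 1) r)) := by omega
        rw [← add_assoc, gPrefix, ihr (by omega), gPrefix, h4]
        simp
    have hnext : piLen m (x + 1) = L + 1 + N := by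
      refine nth_succ_eq hA ?_ (show L < _ by omega) fun j hj hj' => ?_
      · rw [hpre N le_rfl]
        exact curl_seg_le hm hT x
      · obtain ⟨r, rfl⟩ := Nat.exists_eq_add_of_le (show L + 1 ≤ j from hj)
        rw [hpre r (by omega)]
        have := hlt r (by omega)
        omega
    rw [piStr, hnext, hpre N le_rfl, seg, hgap.symm, zero_add]

end Structure

theorem replicate_Bstr_flatten {m : ℕ} (hm : 1 ≤ m)
    (hA : {k : ℕ | curl (gPrefix m k) ≤ m}.Infinite)
    (hT : {k : ℕ | curl (gPrefix (m + 1) k) ≤ m}.Infinite) (s μ : ℕ) :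
    (List.replicate μ (Bstr m (s + 1))).flatten
      = seg m (cappedGap m s) 0 (μ * (m + 1) ^ s) := by
  rw [seg_mul_of_periodic _ _ (cappedGap_add hm s), Bstr, piStr_eq_seg hm hA hT,
    Nat.add_sub_cancel]
  congr 2
  refine seg_congr fun i hi => (cappedGap_eq hm (by omega) fun h => ?_).symm
  have h1 := Nat.le_of_dvd (by omega) h
  have h2 : (m + 1) ^ s < (m + 1) ^ (s + 1) := Nat.pow_lt_pow_succ (by omega)
  omega

end Gijswijt

open Gijswijt

/-- the square/double lemma. If `π^(n)(1,x) = Q·X·X` with `n ∈ X`, then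
either `X` is a conjugate of `(B_t^(n))^μ` with `1 ≤ μ ≤ ⌊(n+1)/2⌋`, or the exceptional
case (2) holds. -/
theorem statement1 (hSH : StandingHyp) (n x : ℕ) (hn : 1 ≤ n) (hx : 1 ≤ x)
    (Q X : List ℕ) (hmem : n ∈ X) (hdecomp : piStr n x = Q ++ X ++ X) :
    (∃ t μ : ℕ, 1 ≤ t ∧ 1 ≤ μ ∧ μ ≤ (n + 1) / 2 ∧
      ∃ U V : List ℕ,
        (List.replicate μ (Bstr n t)).flatten = U ++ V ∧ X = V ++ U) ∨
    (∃ t u μ ρ : ℕ, 2 ≤ t ∧ t < u ∧ 1 ≤ μ ∧ μ ≤ n ∧ 1 ≤ ρ ∧ ¬(n + 1) ∣ ρ ∧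
      ∃ S : List ℕ, S ≠ [] ∧ S <:+ Tstr n t ∧ Tstr n t ++ S = Tstr n u ∧
        x = ρ * (n + 1) ^ (u - 1) + μ * (n + 1) ^ (t - 1) ∧
        Q ++ S = piStr n (ρ * (n + 1) ^ (u - 1) - μ * (n + 1) ^ (t - 1))) := by
  obtain ⟨hA, hT⟩ := hSH n hn
  have hb : 2 ≤ n + 1 := by omega
  obtain ⟨y, rfl⟩ := Nat.exists_eq_succ_of_ne_zero (show x ≠ 0 by omega)
  simp only [Nat.succ_eq_add_one] at *
  have hword : seg n (gap n) 0 y ++ n :: gap n (y + 1) = Q ++ (List.replicate 2 X).flatten := by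
    rw [piStr_eq_seg hn hA hT, seg, zero_add] at hdecomp
    rw [hdecomp]
    simp
  obtain ⟨h1, h2, h3, P, hP, h4, h5, h6⟩ :=
    exists_of_power_suffix (not_mem_gap n) (not_mem_gap n _) hmem le_rfl hword
  set c := X.count n
  have hper : ∀ j, y + 1 + c < j + 2 * c → j < y + 1 →
    multiplicity (n + 1) j = multiplicity (n + 1) (j - c) :=
    fun j hj hj' => gap_inj hT (h3 j hj hj')
  rcases (le_of_gap_prefix hT ⟨P, h4.symm⟩).eq_or_lt with heq | hlt
  · left
    obtain ⟨s, μ, h7, h8, h9, h10⟩ := (isVal hn).exists_of_periodic hb h1 le_rfl h2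
      fun j hj hj' => by
        rcases hj'.eq_or_lt with rfl | hj'
        · exact heq
        · exact hper j hj hj'
    have hP0 : P = [] := by
      have := congrArg List.length h4
      rw [gap, ← heq, ← gap, List.length_append] at this
      exact List.length_eq_zero_iff.1 (by omega)
    have hX : X = seg n (cappedGap n s) (y + 1 - c) (μ * (n + 1) ^ s) := by
      have h11 : seg n (gap n) (y + 1 - c) c = X := by
        rw [h6, hP0]
        conv_lhs => rw [show c = c - 1 + 1 by omega]
        rw [seg, show y + 1 - (c - 1 + 1) + (c - 1) + 1 = y + 1 by omega,
          show c - 1 + 1 = c by omega]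
        rfl
      rw [← h11, ← h7]
      exact seg_congr fun i hi =>
        (cappedGap_eq hn (by omega) (h10 _ (by omega) (by omega))).symm
    obtain ⟨U, V, h12, h13⟩ := exists_conj_of_periodic (m := n) (y + 1 - c) μ
      (show 0 < (n + 1) ^ s by positivity) h8 (cappedGap_add hn s)
    exact ⟨s + 1, μ, by omega, h8, by omega, U, V,
      (replicate_Bstr_flatten hn hA hT s μ).trans h12, hX.trans h13⟩
  · right
    obtain ⟨-, h7, h8, h9, h10⟩ := (isVal hn).of_lt hb h1 le_rfl h2 hper hlt
    set t := multiplicity (n + 1) (y + 1)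
    set u := multiplicity (n + 1) (y + 1 - c)
    have hPs : P <:+ Tstr n (t + 1) := by
      have := suffix_gap (by omega) hP h5
      rwa [gap, h10] at this
    have hTu : Tstr n (t + 1) ++ P = Tstr n (u + 1) := h4.symm
    have hPne : P ≠ [] := by
      rintro rfl
      rw [List.append_nil] at h4
      exact hlt.ne (gap_inj hT h4).symm
    have ht1 : 1 ≤ t := by
      by_contra h
      have h0 : t = 0 := by omega
      have hT1 : Tstr n 1 = [] := Tstr_one hn
      rw [h0, zero_add, hT1] at hPs
      exact hPne (List.suffix_nil.1 hPs)
    obtain ⟨μ, hμ⟩ := h7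
    have hv := isVal hn (y + 1 - c) (by omega)
    obtain ⟨ρ, hρ⟩ := (hv u).2 le_rfl
    have hμ' : c = μ * (n + 1) ^ t := by rw [hμ, mul_comm]
    have hρ' : y + 1 - c = ρ * (n + 1) ^ u := by rw [hρ, mul_comm]
    refine ⟨t + 1, u + 1, μ, ρ, by omega, by omega, ?_, ?_, ?_, ?_, P, hPne, hPs, hTu, ?_, ?_⟩
    · exact Nat.pos_of_ne_zero fun h => by simp [h] at hμ; omega
    · rw [hμ', pow_succ, mul_comm] at h8
      exact Nat.lt_succ_iff.1 (Nat.lt_of_mul_lt_mul_left h8)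
    · exact Nat.pos_of_ne_zero fun h => by simp [h] at hρ; omega
    · rintro ⟨d, rfl⟩
      exact Nat.not_succ_le_self u ((hv (u + 1)).1 ⟨d, by rw [hρ]; ring⟩)
    · rw [Nat.add_sub_cancel, Nat.add_sub_cancel, ← hρ', ← hμ']
      omega
    · rw [Nat.add_sub_cancel, Nat.add_sub_cancel, ← hρ', ← hμ', piStr_eq_seg hn hA hT, h5]
      congr 1
      omega
end

section
/- Let m ≥ 1 and x ≥ 1, and suppose π^(m)(1,x) has a suffix of the form X·X·X with X nonempty. Then there exist integers n ≥ m, t ≥ 1 and μ ≥ 1 such that X is a conjugate of (B_t^(n))^μ. -/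
open List Filter

open scoped Classical

/-! ### Decomposition of a word at the occurrences of a letter -/

lemma eq_of_append_cons_eq {m : ℕ} {P P' R R' : List ℕ} (hP : m ∉ P) (hP' : m ∉ P')
    (h : P ++ m :: R = P' ++ m :: R') : P = P' ∧ R = R' := by
  induction P generalizing P' with
  | nil =>
    cases P' with
    | nil => simpa using h
    | cons a P' =>
      simp only [List.nil_append, List.cons_append, List.cons.injEq] at h
      simp [h.1] at hP'
  | cons a P ih =>
    cases P' with
    | nil =>
      simp only [List.nil_append, List.cons_append, List.cons.injEq] at h
      simp [h.1] at hP
    | cons b P' =>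
      simp only [List.mem_cons, not_or] at hP hP'
      simp only [List.cons_append, List.cons.injEq] at h
      obtain ⟨h1, h2⟩ := ih hP.2 hP'.2 h.2
      exact ⟨by rw [h.1, h1], h2⟩

lemma blocks_unique {m : ℕ} {P P' : List ℕ} {Zs Zs' : List (List ℕ)} (hP : m ∉ P) (hP' : m ∉ P')
    (hZ : ∀ Z ∈ Zs, m ∉ Z) (hZ' : ∀ Z ∈ Zs', m ∉ Z)
    (h : P ++ Zs.flatMap (m :: ·) = P' ++ Zs'.flatMap (m :: ·)) : P = P' ∧ Zs = Zs' := by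
  induction Zs generalizing P P' Zs' with
  | nil =>
    cases Zs' with
    | nil => simpa using h
    | cons Z' Zs' =>
      exfalso
      apply hP
      simp only [List.flatMap_nil, List.append_nil] at h
      rw [h]
      simp
  | cons Z Zs ih =>
    cases Zs' with
    | nil =>
      exfalso
      apply hP'
      simp only [List.flatMap_nil, List.append_nil] at h
      rw [← h]
      simp
    | cons Z' Zs' =>
      simp only [List.flatMap_cons, List.cons_append] at h
      obtain ⟨h1, h2⟩ := eq_of_append_cons_eq hP hP' h
      obtain ⟨h3, h4⟩ := ih (hZ _ (by simp)) (hZ' _ (by simp))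
        (fun Y hY => hZ _ (by simp [hY])) (fun Y hY => hZ' _ (by simp [hY])) h2
      exact ⟨h1, by rw [h3, h4]⟩

lemma exists_blocks (m : ℕ) (L : List ℕ) : ∃ (P : List ℕ) (Zs : List (List ℕ)),
    m ∉ P ∧ (∀ Z ∈ Zs, m ∉ Z) ∧ L = P ++ Zs.flatMap (m :: ·) := by
  induction L with
  | nil => exact ⟨[], [], by simp⟩
  | cons a L ih =>
    obtain ⟨P, Zs, hP, hZ, rfl⟩ := ih
    by_cases ha : a = m
    · subst ha
      refine ⟨[], P :: Zs, by simp, ?_, by simp⟩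
      simp only [List.mem_cons, forall_eq_or_imp]
      exact ⟨hP, hZ⟩
    · refine ⟨a :: P, Zs, ?_, hZ, by simp⟩
      simp only [List.mem_cons, not_or]
      exact ⟨fun h => ha h.symm, hP⟩

lemma flatten_replicate_blocks (m k : ℕ) (P Z : List ℕ) (C : List (List ℕ)) :
    (List.replicate (k + 1) (P ++ (C ++ [Z]).flatMap (m :: ·))).flatten =
      P ++ ((List.replicate k (C ++ [Z ++ P])).flatten ++ C ++ [Z]).flatMap (m :: ·) := by
  induction k with
  | zero => simp
  | succ k ih =>
    rw [List.replicate_succ, List.flatten_cons, ih, List.replicate_succ (n := k)]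
    simp

lemma eq_map_range_of_append {f : ℕ → List ℕ} {x : ℕ} {A B E : List (List ℕ)}
    (h : (List.range x).map f = A ++ B ++ E) :
    B = (List.range B.length).map (fun i => f (A.length + i)) := by
  have hx : x = A.length + B.length + E.length := by
    simpa [add_assoc] using congrArg List.length h
  subst hx
  rw [List.range_add, List.range_add] at h
  simp only [List.map_append, List.map_map] at h
  have h1 := (List.append_inj h (by simp)).1
  have h2 := (List.append_inj h1 (by simp)).2
  rw [← h2]
  simp [Function.comp_def]

lemma power_blocks_list {m k x : ℕ} {f : ℕ → List ℕ} {G Y Z : List ℕ}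
    (hf : ∀ i, m ∉ f i) (hZ : m ∉ Z) (hY : m ∈ Y)
    (h : (List.range x).flatMap (fun i => m :: f i) ++ m :: Z =
      G ++ (List.replicate (k + 1) Y).flatten) :
    ∃ (P Q : List ℕ) (C D : List (List ℕ)), Y = P ++ Q ∧
      Q ++ P = (C ++ [Z ++ P]).flatMap (m :: ·) ∧
      (List.range x).map f = D ++ (List.replicate k (C ++ [Z ++ P])).flatten ++ C ∧
      (P ≠ [] → ∃ D' Gl, D = D' ++ [Gl ++ P]) := by
  obtain ⟨P, Zs, hP, hZs, rfl⟩ := exists_blocks m Y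
  obtain ⟨P₀, Gs, hP₀, hGs, rfl⟩ := exists_blocks m G
  have hne : Zs ≠ [] := by
    rintro rfl
    simp [hP] at hY
  obtain ⟨C, Zl, rfl⟩ : ∃ C Zl, Zs = C ++ [Zl] :=
    ⟨Zs.dropLast, Zs.getLast hne, (List.dropLast_append_getLast hne).symm⟩
  have hC : ∀ V ∈ C, m ∉ V := fun V hV => hZs V (by simp [hV])
  have hZl : m ∉ Zl := hZs _ (by simp)
  have hlhs : (List.range x).flatMap (fun i => m :: f i) ++ m :: Z =
      [] ++ ((List.range x).map f ++ [Z]).flatMap (m :: ·) := by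
    simp [List.flatMap_map]
  have hl : ∀ V ∈ (List.range x).map f ++ [Z], m ∉ V := by
    simp only [List.mem_append, List.mem_map, List.mem_singleton]
    rintro V (⟨i, -, rfl⟩ | rfl)
    · exact hf i
    · exact hZ
  have hpow : ∀ V ∈ (List.replicate k (C ++ [Zl ++ P])).flatten ++ C ++ [Zl], m ∉ V := by
    simp only [List.mem_append, List.mem_flatten, List.mem_replicate, List.mem_singleton]
    rintro V ((⟨L, ⟨-, rfl⟩, hV⟩ | hV) | rfl)
    · simp only [List.mem_append, List.mem_singleton] at hV
      rcases hV with hV | rfl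
      · exact hC _ hV
      · simp [hZl, hP]
    · exact hC _ hV
    · exact hZl
  rw [hlhs, flatten_replicate_blocks] at h
  refine ⟨P, (C ++ [Zl]).flatMap (m :: ·), C, ?_⟩
  rcases List.eq_nil_or_concat Gs with rfl | ⟨D', Gl, rfl⟩
  · simp only [List.flatMap_nil, List.append_nil, ← List.append_assoc P₀] at h
    obtain ⟨h1, h2⟩ := blocks_unique (by simp) (by simp [hP₀, hP]) hl hpow h
    have h1' : P = [] := by simpa using (List.append_eq_nil_iff.1 h1.symm).2
    obtain ⟨h3, h4⟩ := List.append_inj' h2 (by simp)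
    simp only [List.cons.injEq, and_true] at h4
    subst h4
    exact ⟨[], rfl, by simp [h1'], by simpa using h3, fun h => absurd h1' h⟩
  · have h' : [] ++ ((List.range x).map f ++ [Z]).flatMap (m :: ·) = P₀ ++ (D' ++ [Gl ++ P] ++
        ((List.replicate k (C ++ [Zl ++ P])).flatten ++ C ++ [Zl])).flatMap (m :: ·) := by
      rw [h]; simp
    obtain ⟨h1, h2⟩ := blocks_unique (by simp) hP₀ hl (by
      intro V hV
      rcases List.mem_append.1 hV with hV | hV
      · rcases List.mem_append.1 hV with hV | hV
        · exact hGs _ (by simp [hV])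
        · rw [List.mem_singleton] at hV
          subst hV
          simpa [hP] using hGs Gl (by simp)
      · exact hpow V hV) h'
    rw [← List.append_assoc, ← List.append_assoc] at h2
    obtain ⟨h3, h4⟩ := List.append_inj' h2 (by simp)
    simp only [List.cons.injEq, and_true] at h4
    subst h4
    exact ⟨D' ++ [Gl ++ P], rfl, by simp, h3, fun _ => ⟨D', Gl, rfl⟩⟩

/-- A power containing the letter `m` forces the sequence of blocks to be periodic. -/
lemma power_blocks {m k x : ℕ} {f : ℕ → List ℕ} {G Y Z : List ℕ}
    (hf : ∀ i, m ∉ f i) (hZ : m ∉ Z) (hY : m ∈ Y)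
    (h : (List.range x).flatMap (fun i => m :: f i) ++ m :: Z =
      G ++ (List.replicate (k + 2) Y).flatten) :
    ∃ (q d : ℕ) (P Q : List ℕ), 1 ≤ q ∧ d + (k + 2) * q = x + 1 ∧ Y = P ++ Q ∧
      Q ++ P = (List.range q).flatMap (fun i => m :: f (d + i)) ∧
      (∀ i, d ≤ i → i + q < x → f i = f (i + q)) ∧ f (x - q) = Z ++ P ∧
      (P ≠ [] → 1 ≤ d ∧ ∃ Gl, f (d - 1) = Gl ++ P) := by
  obtain ⟨P, Q, C, D, hPQ, hQP, hl, hD⟩ := power_blocks_list hf hZ hY h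
  have hx : x = D.length + (k + 1) * (C.length + 1) + C.length := by
    simpa [add_assoc] using congrArg List.length hl
  have hx' : x = D.length + (k * (C.length + 1) + C.length) + 1 + C.length := by
    rw [hx]; ring
  refine ⟨C.length + 1, D.length, P, Q, by omega, by rw [hx]; ring, hPQ, ?_, ?_, ?_, ?_⟩
  · have h1 : (List.range x).map f = D ++ (C ++ [Z ++ P]) ++
        ((List.replicate k (C ++ [Z ++ P])).flatten ++ C) := by
      rw [hl, List.replicate_succ]; simp
    have h2 := eq_map_range_of_append h1
    rw [hQP, h2]
    simp [List.flatMap_map]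
  · have h1 : (List.range x).map f = (D ++ (C ++ [Z ++ P])) ++
        ((List.replicate k (C ++ [Z ++ P])).flatten ++ C) ++ [] := by
      rw [hl, List.replicate_succ]; simp
    have h2 : (List.range x).map f = D ++
        ((List.replicate k (C ++ [Z ++ P])).flatten ++ C) ++ ([Z ++ P] ++ C) := by
      rw [hl, List.replicate_succ']; simp
    have h3 := (eq_map_range_of_append h1).symm.trans (eq_map_range_of_append h2)
    intro i hi hiq
    have h4 := List.map_inj_left.1 h3 (i - D.length) (by
      simp only [List.mem_range, List.length_append, List.length_flatten, List.map_replicate,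
        List.sum_replicate, List.length_singleton, smul_eq_mul]
      omega)
    have e1 : (D ++ (C ++ [Z ++ P])).length + (i - D.length) = i + (C.length + 1) := by
      simp only [List.length_append, List.length_singleton]; omega
    have e2 : D.length + (i - D.length) = i := by omega
    rw [e1, e2] at h4
    exact h4.symm
  · have h2 : (List.range x).map f = (D ++
        ((List.replicate k (C ++ [Z ++ P])).flatten ++ C)) ++ [Z ++ P] ++ C := by
      rw [hl, List.replicate_succ']; simp
    have h3 := eq_map_range_of_append h2
    simp only [List.length_singleton, List.range_one, List.map_cons, List.map_nil,
      List.cons.injEq, and_true, add_zero] at h3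
    rw [h3]
    congr 1
    simp only [List.length_append, List.length_flatten, List.map_replicate,
        List.sum_replicate, List.length_singleton, smul_eq_mul]
    omega
  · intro hP
    obtain ⟨D', Gl, rfl⟩ := hD hP
    refine ⟨by simp, Gl, ?_⟩
    have h2 : (List.range x).map f = D' ++ [Gl ++ P] ++
        ((List.replicate (k + 1) (C ++ [Z ++ P])).flatten ++ C) := by
      rw [hl]; simp
    have h3 := eq_map_range_of_append h2
    simp only [List.length_singleton, List.range_one, List.map_cons, List.map_nil,
      List.cons.injEq, and_true, add_zero] at h3
    rw [h3]
    simp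

/-! ### Arithmetic of periodic divisibility -/

lemma not_dvd_of_period {M q k d x : ℕ} (hk : 2 ≤ k) (hq : ¬ M ∣ q) (hx : d + k * q = x)
    (hper : ∀ j, d < j → j + q < x → (M ∣ j ↔ M ∣ j + q)) {j : ℕ} (hdj : d < j) (hjx : j < x)
    (hj : 3 ≤ k ∨ j ≠ x - q) : ¬ M ∣ j := by
  intro hM
  have h2 : 2 * q ≤ k * q := Nat.mul_le_mul_right q hk
  have h3 : 3 ≤ k → 3 * q ≤ k * q := fun h => Nat.mul_le_mul_right q h
  have hq0 : 0 < q := Nat.pos_of_ne_zero (by rintro rfl; simp at hq)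
  by_cases hlt : j + q < x
  · exact hq ((Nat.dvd_add_right hM).1 ((hper j hdj hlt).1 hM))
  · have hd : d < j - q := by
      rcases hj with hj | hj
      · have := h3 hj
        omega
      · omega
    have e : j - q + q = j := by omega
    have h4 := (hper (j - q) hd (by omega)).2 (by rwa [e])
    exact hq ((Nat.dvd_add_right h4).1 (by rwa [e]))

lemma exists_multiple_in_Ioc {M : ℕ} (hM : 0 < M) (d : ℕ) : ∃ j, M ∣ j ∧ d < j ∧ j ≤ d + M := by
  refine ⟨(d / M + 1) * M, Dvd.intro_left _ rfl, ?_, ?_⟩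
  · have := Nat.lt_div_mul_add (a := d) hM
    rw [add_mul, one_mul]
    exact this
  · have := Nat.div_mul_le_self d M
    rw [add_mul, one_mul]
    omega

lemma eq_of_no_multiple {b B q k d x : ℕ} (hB : 0 < B) (hb : 0 < b) (hBq : B ∣ q) (hq : 0 < q)
    (hk : b ≤ k) (hx : d + k * q = x) (hno : ∀ j, d < j → j < x → ¬ b * B ∣ j) :
    k = b ∧ q = B ∧ b * B ∣ x := by
  obtain ⟨j, hj, hdj, hjd⟩ := exists_multiple_in_Ioc (Nat.mul_pos hb hB) d
  have hxj : x ≤ j := by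
    by_contra! h
    exact hno j hdj h hj
  have h1 : B ≤ q := Nat.le_of_dvd hq hBq
  have h2 : b * B ≤ b * q := Nat.mul_le_mul_left b h1
  have h3 : b * q ≤ k * q := Nat.mul_le_mul_right q hk
  have h4 : k * q = b * q := by omega
  have h5 : b * q = b * B := by omega
  refine ⟨Nat.eq_of_mul_eq_mul_right hq h4, Nat.eq_of_mul_eq_mul_left hb h5, ?_⟩
  have : x = j := by omega
  rwa [this]

lemma pow_dvd_iff_le_multiplicity {b n k : ℕ} (hb : 2 ≤ b) (hn : 0 < n) :
    b ^ k ∣ n ↔ k ≤ multiplicity b n :=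
  (Nat.finiteMultiplicity_iff.2 ⟨by omega, hn⟩).pow_dvd_iff_le_multiplicity

lemma multiplicity_eq_of_pow_dvd {b n s : ℕ} (hb : 2 ≤ b) (hn : 0 < n) (h1 : b ^ s ∣ n)
    (h2 : ¬ b ^ (s + 1) ∣ n) : multiplicity b n = s := by
  rw [pow_dvd_iff_le_multiplicity hb hn] at h1 h2
  omega

lemma multiplicity_add_of_lt {b n a e : ℕ} (hb : 2 ≤ b) (hn : 0 < n) (hlt : n < b ^ e)
    (ha : b ^ e ∣ a) : multiplicity b (a + n) = multiplicity b n := by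
  have h : ∀ k, k ≤ multiplicity b (a + n) ↔ k ≤ multiplicity b n := by
    intro k
    rw [← pow_dvd_iff_le_multiplicity hb (by omega), ← pow_dvd_iff_le_multiplicity hb hn]
    rcases le_or_gt k e with hk | hk
    · exact Nat.dvd_add_right ((pow_dvd_pow b hk).trans ha)
    · have he : b ^ e ∣ b ^ k := pow_dvd_pow b hk.le
      constructor
      · intro h
        have := (Nat.dvd_add_right ha).1 (he.trans h)
        exact absurd (Nat.le_of_dvd hn this) (by omega)
      · intro h
        exact absurd (Nat.le_of_dvd hn (he.trans h)) (by omega)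
  exact le_antisymm ((h _).1 le_rfl) ((h _).2 le_rfl)

/-! ### Curling numbers and prefixes -/

lemma le_length_of_power {S X Y : List ℕ} {k : ℕ} (hY : Y ≠ [])
    (h : S = X ++ (List.replicate k Y).flatten) : k ≤ S.length := by
  have h1 : 1 ≤ Y.length := List.length_pos_iff.2 hY
  subst h
  simp only [List.length_append, List.length_flatten, List.map_replicate, List.sum_replicate,
    smul_eq_mul]
  nlinarith

lemma le_curl {S X Y : List ℕ} {k : ℕ} (hY : Y ≠ [])
    (h : S = X ++ (List.replicate k Y).flatten) : k ≤ curl S := by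
  refine le_trans (le_csSup ?_ ?_) (le_max_right _ _)
  · exact ⟨S.length, by rintro k ⟨X, Y, hY, h⟩; exact le_length_of_power hY h⟩
  · exact ⟨X, Y, hY, h⟩

lemma curl_le {S : List ℕ} {c : ℕ} (hc : 1 ≤ c)
    (h : ∀ (k : ℕ) (X Y : List ℕ), Y ≠ [] → S = X ++ (List.replicate k Y).flatten → k ≤ c) :
    curl S ≤ c := by
  refine max_le hc (csSup_le' ?_)
  rintro k ⟨X, Y, hY, hS⟩
  exact h k X Y hY hS

lemma curl_le_curl_append (A S : List ℕ) : curl S ≤ curl (A ++ S) := by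
  refine curl_le (le_max_left _ _) ?_
  rintro k X Y hY rfl
  exact le_curl (X := A ++ X) hY (by simp)

@[simp] lemma length_gPrefix (m n : ℕ) : (gPrefix m n).length = n := by
  induction n with
  | zero => rfl
  | succ n ih => simp [gPrefix, ih]

lemma gPrefix_prefix (m : ℕ) {n n' : ℕ} (h : n ≤ n') : gPrefix m n <+: gPrefix m n' := by
  induction n', h using Nat.le_induction with
  | base => exact List.prefix_rfl
  | succ n' _ ih => exact ih.trans (List.prefix_append _ _)

lemma notMem_gPrefix_succ (m n : ℕ) : m ∉ gPrefix (m + 1) n := by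
  induction n with
  | zero => simp [gPrefix]
  | succ n ih =>
    simp only [gPrefix, List.mem_append, List.mem_singleton, not_or]
    refine ⟨ih, ?_⟩
    have := le_max_left (m + 1) (curl (gPrefix (m + 1) n))
    omega

/-- A suffix avoiding `m` of a word ending in the block `m :: Z` is a suffix of `Z`. -/
lemma suffix_of_notMem {m : ℕ} {W Z G R : List ℕ} (hR : m ∉ R) (h : W ++ m :: Z = G ++ R) :
    ∃ E, Z = E ++ R := by
  rcases List.append_eq_append_iff.1 h with ⟨as, h1, h2⟩ | ⟨bs, h1, h2⟩
  · cases as with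
    | nil =>
      simp only [List.nil_append] at h2
      exact absurd (by simp [← h2]) hR
    | cons a as =>
      simp only [List.cons_append, List.cons.injEq] at h2
      exact ⟨as, h2.2⟩
  · exact absurd (by simp [h2]) hR

/-! ### The block structure of the level-`m` sequence -/

/-- The length of the `j`-th (from 0) prefix of `A^(m+1)` with curling number at most `m`. -/
noncomputable def tailLen (m j : ℕ) : ℕ := Nat.nth (fun k => curl (gPrefix (m + 1) k) ≤ m) j

/-- The `i`-th block tail (from 0), a prefix of `A^(m+1)`. -/
noncomputable def blockTail (m i : ℕ) : List ℕ :=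
  gPrefix (m + 1) (tailLen m (multiplicity (m + 1) (i + 1)))

/-- The concatenation of the first `x` blocks. -/
noncomputable def blockWord (m x : ℕ) : List ℕ :=
  (List.range x).flatMap (fun i => m :: blockTail m i)

lemma blockWord_succ (m x : ℕ) :
    blockWord m (x + 1) = blockWord m x ++ m :: blockTail m x := by
  simp [blockWord, List.range_succ]

lemma notMem_blockTail (m i : ℕ) : m ∉ blockTail m i := notMem_gPrefix_succ _ _

lemma blockTail_inj {m i j : ℕ} (ht : StrictMono (tailLen m))
    (h : blockTail m i = blockTail m j) :
    multiplicity (m + 1) (i + 1) = multiplicity (m + 1) (j + 1) := by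
  have := congrArg List.length h
  simp only [blockTail, length_gPrefix] at this
  exact ht.injective this

lemma blockWord_pow_add {m e n a : ℕ} (hm : 1 ≤ m) (hn : n < (m + 1) ^ e)
    (ha : (m + 1) ^ e ∣ a) : blockWord m (a + n) = blockWord m a ++ blockWord m n := by
  rw [blockWord, List.range_add, List.flatMap_append]
  congr 1
  rw [blockWord, List.flatMap_map]
  apply List.flatMap_congr
  intro i hi
  have := List.mem_range.1 hi
  rw [blockTail, blockTail, add_assoc, multiplicity_add_of_lt (by omega) (by omega) _ ha]
  omega

lemma multiplicity_self_pow {b s : ℕ} (hb : 2 ≤ b) : multiplicity b (b ^ s) = s :=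
  multiplicity_eq_of_pow_dvd hb (by positivity) dvd_rfl
    (fun h => absurd (Nat.le_of_dvd (by positivity) h)
      (not_le.2 (Nat.pow_lt_pow_right (by omega) (by omega))))

lemma blockWord_pow_pred {m s : ℕ} (hm : 1 ≤ m) :
    blockWord m ((m + 1) ^ s - 1) ++ m :: gPrefix (m + 1) (tailLen m s) =
      blockWord m ((m + 1) ^ s) := by
  have hB : 0 < (m + 1) ^ s := by positivity
  obtain ⟨n, hn⟩ : ∃ n, (m + 1) ^ s = n + 1 := ⟨_, (Nat.sub_add_cancel hB).symm⟩
  have h := multiplicity_self_pow (b := m + 1) (s := s) (by omega)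
  rw [hn] at h ⊢
  rw [blockWord_succ, blockTail, h, Nat.add_sub_cancel]

lemma blockWord_mul_pow {m s k : ℕ} (hm : 1 ≤ m) (hk : k ≤ m) :
    blockWord m (k * (m + 1) ^ s) = (List.replicate k (blockWord m ((m + 1) ^ s))).flatten := by
  induction k with
  | zero => simp [blockWord]
  | succ k ih =>
    have hB : 0 < (m + 1) ^ s := by positivity
    have e : (k + 1) * (m + 1) ^ s = k * (m + 1) ^ s + ((m + 1) ^ s - 1) + 1 := by
      rw [add_mul, one_mul]; omega
    have hv : multiplicity (m + 1) ((k + 1) * (m + 1) ^ s) = s := by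
      refine multiplicity_eq_of_pow_dvd (by omega) (by positivity) (Dvd.intro_left _ rfl) ?_
      intro h
      rw [pow_succ', Nat.mul_dvd_mul_iff_right hB] at h
      exact absurd (Nat.le_of_dvd (by omega) h) (by omega)
    rw [e] at hv
    rw [e, blockWord_succ, blockTail, hv,
      blockWord_pow_add (e := s) hm (by omega) (Dvd.intro_left _ rfl), List.append_assoc,
      blockWord_pow_pred hm, ih (by omega), List.replicate_succ', List.flatten_append]
    simp

lemma exists_power_suffix {m x s : ℕ} (hm : 1 ≤ m) (hx : (m + 1) ^ (s + 1) ∣ x + 1) :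
    ∃ G, blockWord m x ++ m :: gPrefix (m + 1) (tailLen m s) =
      G ++ (List.replicate (m + 1) (blockWord m ((m + 1) ^ s))).flatten := by
  have hB : 0 < (m + 1) ^ s := by positivity
  have hle := Nat.le_of_dvd (by omega) hx
  have hM : (m + 1) ^ (s + 1) = m * (m + 1) ^ s + (m + 1) ^ s := by ring
  obtain ⟨a, ha⟩ : ∃ a, x + 1 = a + (m + 1) ^ (s + 1) := ⟨_, (Nat.sub_add_cancel hle).symm⟩
  have hda : (m + 1) ^ (s + 1) ∣ a := by
    rw [ha] at hx
    exact (Nat.dvd_add_left dvd_rfl).1 hx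
  have e : x = a + (m * (m + 1) ^ s + ((m + 1) ^ s - 1)) := by omega
  refine ⟨blockWord m a, ?_⟩
  rw [e, blockWord_pow_add (e := s + 1) hm (by omega) hda,
    blockWord_pow_add (e := s) hm (by omega) (Dvd.intro_left _ rfl), blockWord_mul_pow hm le_rfl,
    List.append_assoc, List.append_assoc, blockWord_pow_pred hm, List.replicate_succ',
    List.flatten_append]
  simp

lemma not_square_overlap {N T' Z P Gl : List ℕ} (hN : curl N ≤ 1) (hT : T' <+: N) (hne : T' ≠ N)
    (hZ : Z.length ≤ T'.length) (h1 : N = Z ++ P) (h2 : T' = Gl ++ P) : False := by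
  obtain ⟨E, hE⟩ := hT
  have hE0 : E ≠ [] := by
    rintro rfl
    exact hne (by simpa using hE)
  obtain ⟨P₁, h3, h4⟩ | ⟨P₁, h3, h4⟩ := List.append_eq_append_iff.1 (h1.symm.trans hE.symm)
  · have h5 : N = (Gl ++ P₁) ++ (List.replicate 2 E).flatten := by
      rw [← hE, h2, h4]
      simp [List.replicate_succ]
    have := le_curl hE0 h5
    omega
  · have : P₁ = [] := by
      have := congrArg List.length h3
      rw [List.length_append] at this
      exact List.length_eq_zero_iff.1 (by omega)
    subst this
    simp only [List.nil_append, List.append_nil] at h3 h4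
    have h5 : N = Gl ++ (List.replicate 2 E).flatten := by
      rw [← hE, h2, h4]
      simp [List.replicate_succ]
    have := le_curl hE0 h5
    omega

lemma curl_tail_le {m : ℕ} (hJ : {k | curl (gPrefix (m + 1) k) ≤ m}.Infinite) (j : ℕ) :
    curl (gPrefix (m + 1) (tailLen m j)) ≤ m :=
  Nat.nth_mem_of_infinite hJ j

lemma exists_pow_dvd_not_dvd {b q : ℕ} (hb : 2 ≤ b) (hq : 0 < q) :
    ∃ s, b ^ s ∣ q ∧ ¬ b ^ (s + 1) ∣ q :=
  ⟨multiplicity b q, (pow_dvd_iff_le_multiplicity hb hq).2 le_rfl, fun h => by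
    have := (pow_dvd_iff_le_multiplicity hb hq).1 h
    omega⟩

lemma dvd_iff_of_blockTail_eq {m d q x : ℕ} (hm : 1 ≤ m) (ht : StrictMono (tailLen m))
    (hper : ∀ i, d ≤ i → i + q < x → blockTail m i = blockTail m (i + q)) (e : ℕ) :
    ∀ j, d < j → j + q < x + 1 → ((m + 1) ^ e ∣ j ↔ (m + 1) ^ e ∣ j + q) := by
  intro j hdj hj
  obtain ⟨i, rfl⟩ : ∃ i, j = i + 1 := ⟨j - 1, by omega⟩
  have h := blockTail_inj ht (hper i (by omega) (by omega))
  rw [pow_dvd_iff_le_multiplicity (by omega) (by omega),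
    pow_dvd_iff_le_multiplicity (by omega) (by omega), h, add_right_comm]

/-- A high power that is a suffix and contains the letter `m` is an `(m+1)`-st power and
occurs only strictly inside a block. -/
lemma power_mem_eq {m x l k : ℕ} {G Y : List ℕ} (hm : 1 ≤ m)
    (hJ : {k | curl (gPrefix (m + 1) k) ≤ m}.Infinite) (ht : StrictMono (tailLen m))
    (hl : l ≤ tailLen m (multiplicity (m + 1) (x + 1)))
    (hk : m + 1 ≤ k) (hY : m ∈ Y)
    (h : blockWord m x ++ m :: gPrefix (m + 1) l = G ++ (List.replicate k Y).flatten) :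
    k = m + 1 ∧ l < tailLen m (multiplicity (m + 1) (x + 1)) := by
  obtain ⟨k, rfl⟩ : ∃ k', k = k' + 2 := ⟨k - 2, by omega⟩
  obtain ⟨q, d, P, Q, hq, hx, -, -, hper, hlast, hP⟩ :=
    power_blocks (notMem_blockTail m) (notMem_gPrefix_succ m l) hY h
  obtain ⟨s, hs, hs'⟩ := exists_pow_dvd_not_dvd (b := m + 1) (by omega) hq
  have h2q : 2 * q ≤ (k + 2) * q := Nat.mul_le_mul_right q (by omega)
  have hdvd := dvd_iff_of_blockTail_eq hm ht hper
  have hxq : x - q + 1 = x + 1 - q := by omega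
  have hl1 : (blockTail m (x - q)).length = l + P.length := by rw [hlast]; simp
  simp only [blockTail, length_gPrefix, hxq] at hl1
  have hexc : 3 ≤ k + 2 ∨ ¬ (m + 1) ^ (s + 1) ∣ x + 1 - q := by
    by_contra! hcon
    obtain ⟨hk3, hcon⟩ := hcon
    obtain rfl : k = 0 := by omega
    obtain rfl : m = 1 := by omega
    have hsM : (1 + 1) ^ s ∣ (1 + 1) ^ (s + 1) := pow_dvd_pow _ (by omega)
    have hx1 : x + 1 - q + q = x + 1 := by omega
    have hvx : multiplicity (1 + 1) (x + 1) = s := by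
      refine multiplicity_eq_of_pow_dvd le_rfl (by omega) ?_ ?_
      · rw [← hx1]
        exact dvd_add (hsM.trans hcon) hs
      · rw [← hx1, Nat.dvd_add_right hcon]
        exact hs'
    have hvN : s < multiplicity (1 + 1) (x + 1 - q) :=
      (pow_dvd_iff_le_multiplicity le_rfl (by omega)).1 hcon
    have hlt := ht hvN
    rw [hvx] at hl
    have hPne : P ≠ [] := by
      rintro rfl
      simp only [List.length_nil] at hl1
      omega
    obtain ⟨hd, Gl, hGl⟩ := hP hPne
    have hdq : d + q = x + 1 - q := by omega
    have hvd : multiplicity (1 + 1) d = s := by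
      refine multiplicity_eq_of_pow_dvd le_rfl (by omega) ?_ ?_
      · refine (Nat.dvd_add_left hs).1 ?_
        rw [hdq]
        exact hsM.trans hcon
      · intro hd'
        rw [← hdq, Nat.dvd_add_right hd'] at hcon
        exact hs' hcon
    rw [blockTail, Nat.sub_add_cancel hd, hvd] at hGl
    rw [blockTail, hxq] at hlast
    refine not_square_overlap (curl_tail_le hJ _) (gPrefix_prefix _ hlt.le) ?_ ?_ hlast hGl
    · intro h
      have := congrArg List.length h
      simp only [length_gPrefix] at this
      omega
    · simpa using hl
  have hno : ∀ j, d < j → j < x + 1 → ¬ (m + 1) * (m + 1) ^ s ∣ j := by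
    intro j h1 h2
    rw [← pow_succ']
    by_cases hj : j = x + 1 - q
    · rcases hexc with h3 | h3
      · exact not_dvd_of_period (by omega) hs' hx (hdvd _) h1 h2 (Or.inl h3)
      · rwa [hj]
    · exact not_dvd_of_period (by omega) hs' hx (hdvd _) h1 h2 (Or.inr hj)
  obtain ⟨hkm, hqs, hdx⟩ := eq_of_no_multiple (by positivity) (by omega) hs hq hk hx hno
  refine ⟨hkm, ?_⟩
  rw [← pow_succ'] at hdx
  have hvx : s < multiplicity (m + 1) (x + 1) :=
    (pow_dvd_iff_le_multiplicity (by omega) (by omega)).1 hdx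
  have hx1 : x + 1 - q + q = x + 1 := by omega
  have hvN : multiplicity (m + 1) (x + 1 - q) = s := by
    refine multiplicity_eq_of_pow_dvd (by omega) (by omega) ?_ ?_
    · refine (Nat.dvd_add_left hs).1 ?_
      rw [hx1]
      exact (pow_dvd_pow _ (by omega)).trans hdx
    · intro h3
      rw [← hx1, Nat.dvd_add_right h3] at hdx
      exact hs' hdx
  have := ht hvx
  rw [hvN] at hl1
  omega

lemma power_notMem_le {m l k : ℕ} {W G Y : List ℕ} (hY0 : Y ≠ []) (hY : m ∉ Y)
    (h : W ++ m :: gPrefix (m + 1) l = G ++ (List.replicate k Y).flatten) :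
    k ≤ curl (gPrefix (m + 1) l) := by
  obtain ⟨E, hE⟩ := suffix_of_notMem (by simp [hY]) h
  exact le_curl hY0 hE

lemma curl_block_end {m x : ℕ} (hm : 1 ≤ m)
    (hJ : {k | curl (gPrefix (m + 1) k) ≤ m}.Infinite) (ht : StrictMono (tailLen m)) :
    curl (blockWord m (x + 1)) ≤ m := by
  rw [blockWord_succ]
  refine curl_le hm fun k G Y hY0 h => ?_
  by_cases hY : m ∈ Y
  · by_contra! hk
    exact absurd (power_mem_eq hm hJ ht le_rfl hk hY h).2 (lt_irrefl _)
  · exact (power_notMem_le hY0 hY h).trans (curl_tail_le hJ _)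

lemma max_curl_block {m x l : ℕ} (hm : 1 ≤ m)
    (hJ : {k | curl (gPrefix (m + 1) k) ≤ m}.Infinite) (ht : StrictMono (tailLen m))
    (hl : l < tailLen m (multiplicity (m + 1) (x + 1))) :
    max m (curl (blockWord m x ++ m :: gPrefix (m + 1) l)) =
      max (m + 1) (curl (gPrefix (m + 1) l)) := by
  refine le_antisymm (max_le (by omega) (curl_le (by omega) fun k G Y hY0 h => ?_)) ?_
  · by_cases hY : m ∈ Y
    · by_contra! hk
      have hk' := (le_max_left _ _).trans hk.le
      rw [(power_mem_eq hm hJ ht hl.le hk' hY h).1] at hk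
      exact absurd ((le_max_left _ _).trans_lt hk) (lt_irrefl _)
    · exact (power_notMem_le hY0 hY h).trans (le_max_right _ _)
  · have h1 : curl (gPrefix (m + 1) l) ≤ curl (blockWord m x ++ m :: gPrefix (m + 1) l) := by
      have := curl_le_curl_append (blockWord m x ++ [m]) (gPrefix (m + 1) l)
      simpa using this
    refine max_le ?_ (h1.trans (le_max_right _ _))
    by_cases hc : curl (gPrefix (m + 1) l) ≤ m
    · obtain ⟨s, rfl⟩ : ∃ s, tailLen m s = l := by
        have : l ∈ Set.range (tailLen m) := by
          unfold tailLen
          rw [Nat.range_nth_of_infinite hJ]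
          exact hc
        exact this
      have hs := ht.lt_iff_lt.1 hl
      obtain ⟨G, hG⟩ := exists_power_suffix (s := s) hm
        ((pow_dvd_iff_le_multiplicity (b := m + 1) (by omega) (by omega)).2 hs)
      refine (le_curl ?_ hG).trans (le_max_right _ _)
      rw [← blockWord_pow_pred hm]
      simp
    · exact (not_le.1 hc).trans_le (h1.trans (le_max_right _ _))

lemma gPrefix_block {m x : ℕ} (hm : 1 ≤ m)
    (hJ : {k | curl (gPrefix (m + 1) k) ≤ m}.Infinite) (ht : StrictMono (tailLen m))
    (hx : gPrefix m (blockWord m x).length = blockWord m x) (hc : curl (blockWord m x) ≤ m)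
    {l : ℕ} (hl : l ≤ tailLen m (multiplicity (m + 1) (x + 1))) :
    gPrefix m ((blockWord m x).length + 1 + l) = blockWord m x ++ m :: gPrefix (m + 1) l := by
  induction l with
  | zero => simp [gPrefix, hx, hc]
  | succ l ih =>
    rw [← add_assoc, gPrefix, ih (by omega), max_curl_block hm hJ ht (by omega), gPrefix]
    simp

lemma curl_blockWord_le {m : ℕ} (hm : 1 ≤ m)
    (hJ : {k | curl (gPrefix (m + 1) k) ≤ m}.Infinite) (ht : StrictMono (tailLen m)) (x : ℕ) :
    curl (blockWord m x) ≤ m := by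
  cases x with
  | zero =>
    refine curl_le hm fun k X Y hY h => ?_
    have := le_length_of_power hY h
    simp [blockWord] at this
    omega
  | succ x => exact curl_block_end hm hJ ht

lemma length_blockWord_succ (m x : ℕ) : (blockWord m (x + 1)).length =
    (blockWord m x).length + 1 + tailLen m (multiplicity (m + 1) (x + 1)) := by
  rw [blockWord_succ, List.length_append, List.length_cons, blockTail, length_gPrefix]
  ring

lemma gPrefix_blockWord {m : ℕ} (hm : 1 ≤ m)
    (hJ : {k | curl (gPrefix (m + 1) k) ≤ m}.Infinite) (ht : StrictMono (tailLen m)) (x : ℕ) :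
    gPrefix m (blockWord m x).length = blockWord m x := by
  induction x with
  | zero => simp [blockWord, gPrefix]
  | succ x ih =>
    rw [length_blockWord_succ,
      gPrefix_block hm hJ ht ih (curl_blockWord_le hm hJ ht x) le_rfl, blockWord_succ, blockTail]

/-- The structure theorem: `π^(m)(1,x)` is the concatenation of the first `x` blocks. -/
lemma piStr_eq_blockWord {m : ℕ} (hm : 1 ≤ m)
    (hJ : {k | curl (gPrefix (m + 1) k) ≤ m}.Infinite) (x : ℕ) :
    piStr m x = blockWord m x := by
  have ht : StrictMono (tailLen m) := Nat.nth_strictMono hJ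
  have hmono : StrictMono fun x => (blockWord m x).length :=
    strictMono_nat_of_lt_succ fun x => by
      rw [length_blockWord_succ]
      omega
  have hp : ∀ x, curl (gPrefix m (blockWord m x).length) ≤ m := fun x => by
    rw [gPrefix_blockWord hm hJ ht]
    exact curl_blockWord_le hm hJ ht x
  have hrange : ∀ k, curl (gPrefix m k) ≤ m → k ∈ Set.range fun x => (blockWord m x).length := by
    intro k hk
    by_contra hcon
    have hex : ∃ x, k < (blockWord m x).length := ⟨k + 1, hmono.le_apply⟩
    obtain ⟨y, hy, hmin⟩ : ∃ y, k < (blockWord m y).length ∧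
        ∀ z < y, ¬ k < (blockWord m z).length :=
      ⟨Nat.find hex, Nat.find_spec hex, fun z hz => Nat.find_min hex hz⟩
    cases y with
    | zero => simp [blockWord] at hy
    | succ y =>
      have h1 := hmin y (by omega)
      have h2 : (blockWord m y).length ≠ k := fun h => hcon ⟨y, h⟩
      rw [length_blockWord_succ] at hy
      obtain ⟨l, rfl⟩ : ∃ l, k = (blockWord m y).length + 1 + l :=
        ⟨k - (blockWord m y).length - 1, by omega⟩
      rw [gPrefix_block hm hJ ht (gPrefix_blockWord hm hJ ht y) (curl_blockWord_le hm hJ ht y)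
        (by omega)] at hk
      have h3 := max_curl_block (x := y) (l := l) hm hJ ht (by omega)
      rw [max_eq_left hk] at h3
      have := le_max_left (m + 1) (curl (gPrefix (m + 1) l))
      omega
  have hinf : {k | curl (gPrefix m k) ≤ m}.Infinite :=
    (Set.infinite_range_of_injective hmono.injective).mono (by rintro _ ⟨x, rfl⟩; exact hp x)
  have h := Nat.nth_comp_of_strictMono (n := x) hmono hrange (fun hfi => absurd hfi hinf)
  simp only [hp, Nat.nth_true] at h
  rw [piStr, piLen, ← h, gPrefix_blockWord hm hJ ht]

/-! ### Cubes -/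

lemma isRotated_flatten_rotate (L : List (List ℕ)) (n : ℕ) :
    (L.rotate n).flatten ~r L.flatten := by
  rw [List.rotate_eq_drop_append_take_mod, List.flatten_append]
  conv_rhs => rw [← List.take_append_drop (n % L.length) L, List.flatten_append]
  exact List.isRotated_append

lemma isRotated_flatMap_range {h : ℕ → List ℕ} {q : ℕ} (hper : Function.Periodic h q) (d : ℕ) :
    (List.range q).flatMap (fun i => h (d + i)) ~r (List.range q).flatMap h := by
  have e : (List.range q).map (fun i => h (d + i)) = ((List.range q).map h).rotate d := by
    refine List.ext_getElem (by simp) fun i h1 h2 => ?_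
    rw [List.getElem_rotate]
    simp [hper.map_mod_nat, add_comm]
  rw [List.flatMap_def, List.flatMap_def, e]
  exact isRotated_flatten_rotate _ _

lemma flatMap_range_mul {h : ℕ → List ℕ} {p : ℕ} (hper : Function.Periodic h p) (k : ℕ) :
    (List.range (k * p)).flatMap h = (List.replicate k ((List.range p).flatMap h)).flatten := by
  induction k with
  | zero => simp
  | succ k ih =>
    rw [add_mul, one_mul, List.range_add, List.flatMap_append, ih, List.replicate_succ',
      List.flatten_append, List.flatMap_map]
    simp only [List.flatten_singleton]
    congr 1
    apply List.flatMap_congr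
    intro i _
    rw [add_comm]
    exact hper.nat_mul k i

lemma min_multiplicity_add_pow {b s n : ℕ} (hb : 2 ≤ b) (hn : 0 < n) :
    min (multiplicity b (n + b ^ s)) s = min (multiplicity b n) s := by
  have h : ∀ k, k ≤ min (multiplicity b (n + b ^ s)) s ↔ k ≤ min (multiplicity b n) s := by
    intro k
    rw [le_min_iff, le_min_iff, ← pow_dvd_iff_le_multiplicity hb (by omega),
      ← pow_dvd_iff_le_multiplicity hb hn]
    exact and_congr_left fun hk => Nat.dvd_add_left (pow_dvd_pow b hk)
  exact le_antisymm ((h _).1 le_rfl) ((h _).2 le_rfl)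

/-- The root of a cube containing the letter `m`. -/
lemma cube_mem_isRotated {m x l : ℕ} {G X : List ℕ} (hm : 1 ≤ m) (ht : StrictMono (tailLen m))
    (hX : m ∈ X)
    (h : blockWord m x ++ m :: gPrefix (m + 1) l = G ++ (List.replicate 3 X).flatten) :
    ∃ s u : ℕ, 1 ≤ u ∧ X ~r (List.replicate u (blockWord m ((m + 1) ^ s))).flatten := by
  obtain ⟨q, d, P, Q, hq, hx, rfl, hQP, hper, -, -⟩ :=
    power_blocks (k := 1) (notMem_blockTail m) (notMem_gPrefix_succ m l) hX h
  obtain ⟨s, hs, hs'⟩ := exists_pow_dvd_not_dvd (b := m + 1) (by omega) hq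
  have hno : ∀ j, d < j → j < x + 1 → ¬ (m + 1) ^ (s + 1) ∣ j := fun j h1 h2 =>
    not_dvd_of_period (by omega) hs' hx (dvd_iff_of_blockTail_eq hm ht hper _) h1 h2
      (Or.inl le_rfl)
  obtain ⟨u, hu⟩ := hs
  let f : ℕ → List ℕ :=
    fun i => m :: gPrefix (m + 1) (tailLen m (min (multiplicity (m + 1) (i + 1)) s))
  have hf : Function.Periodic f ((m + 1) ^ s) := fun i => by
    simp only [f]
    rw [add_right_comm, min_multiplicity_add_pow (by omega) (by omega)]
  have hfq : Function.Periodic f q := by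
    rw [hu, mul_comm]
    exact hf.nat_mul u
  have hblock : ∀ i, multiplicity (m + 1) (i + 1) ≤ s → m :: blockTail m i = f i := by
    intro i hi
    simp only [f, blockTail, min_eq_left hi]
  have h1 : Q ++ P = (List.range q).flatMap (fun i => f (d + i)) := by
    rw [hQP]
    apply List.flatMap_congr
    intro i hi
    have hi' := List.mem_range.1 hi
    apply hblock
    have := hno (d + i + 1) (by omega) (by omega)
    rw [pow_dvd_iff_le_multiplicity (by omega) (by omega)] at this
    omega
  have h2 : blockWord m ((m + 1) ^ s) = (List.range ((m + 1) ^ s)).flatMap f := by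
    apply List.flatMap_congr
    intro i hi
    have hi' := List.mem_range.1 hi
    apply hblock
    by_contra! hcon
    have h3 := (pow_dvd_iff_le_multiplicity (b := m + 1) (by omega) (by omega)).2 hcon.le
    have h4 : i + 1 = (m + 1) ^ s := le_antisymm (by omega) (Nat.le_of_dvd (by omega) h3)
    rw [h4, multiplicity_self_pow (by omega)] at hcon
    omega
  refine ⟨s, u, Nat.pos_of_ne_zero (by rintro rfl; omega), ?_⟩
  rw [h2, ← flatMap_range_mul hf, mul_comm, ← hu]
  refine List.isRotated_append.trans ?_
  rw [h1]
  exact isRotated_flatMap_range hfq d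

lemma exists_conjugate_of_isRotated {X L : List ℕ} (h : X ~r L) :
    ∃ U V : List ℕ, L = U ++ V ∧ X = V ++ U := by
  obtain ⟨n, -, hn⟩ := List.isRotated_iff_mod.1 h.symm
  rw [List.rotate_eq_drop_append_take_mod] at hn
  exact ⟨_, _, (List.take_append_drop _ L).symm, hn.symm⟩

lemma exists_conjugate_of_cube_suffix (hSH : StandingHyp) (N : ℕ) : ∀ (m x : ℕ), 1 ≤ m →
    (piStr m x).length = N → ∀ X : List ℕ, X ≠ [] → (X ++ X ++ X) <:+ piStr m x →
    ∃ n t μ : ℕ, m ≤ n ∧ 1 ≤ t ∧ 1 ≤ μ ∧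
      ∃ U V : List ℕ,
        (List.replicate μ (Bstr n t)).flatten = U ++ V ∧ X = V ++ U := by
  induction N using Nat.strong_induction_on with
  | _ N ih =>
  intro m x hm hN X hX hsuf
  have hJ := (hSH m hm).2
  have ht : StrictMono (tailLen m) := Nat.nth_strictMono hJ
  obtain ⟨G, hG⟩ := hsuf
  rw [piStr_eq_blockWord hm hJ] at hG hN
  cases x with
  | zero =>
    simp [blockWord, hX] at hG
  | succ x =>
    have hcube : X ++ X ++ X = (List.replicate 3 X).flatten := by simp [List.replicate_succ]
    have hw := hG.symm
    rw [blockWord_succ, hcube] at hw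
    by_cases hmX : m ∈ X
    · obtain ⟨s, u, hu, hrot⟩ := cube_mem_isRotated hm ht hmX hw
      refine ⟨m, s + 1, u, le_rfl, by omega, hu, ?_⟩
      rw [Bstr, Nat.add_sub_cancel, piStr_eq_blockWord hm hJ]
      exact exists_conjugate_of_isRotated hrot
    · obtain ⟨E, hE⟩ := suffix_of_notMem (by simp [hmX]) hw
      have hc := curl_tail_le hJ (multiplicity (m + 1) (x + 1))
      obtain ⟨y, hy⟩ : ∃ y, piStr (m + 1) y = blockTail m x := by
        obtain ⟨y, -, hy⟩ := Nat.exists_lt_card_nth_eq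
          (p := fun k => curl (gPrefix (m + 1) k) ≤ m + 1)
          (hc.trans (Nat.le_succ m))
        exact ⟨y, by rw [piStr, piLen, hy, blockTail]⟩
      obtain ⟨n, t, μ, hn, h⟩ := ih (blockTail m x).length
        (by rw [← hN, blockWord_succ]; simp; omega) (m + 1) y (by omega) (by rw [hy]) X hX
        ⟨E, by rw [hy, hE, hcube]⟩
      exact ⟨n, t, μ, by omega, h⟩

/-- cubes as suffixes. If `π^(m)(1,x)` has a suffix `X·X·X` with `X`
nonempty, then `X` is a conjugate of `(B_t^(n))^μ` for some `n ≥ m`, `t ≥ 1`, `μ ≥ 1`. -/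
theorem statement2 (hSH : StandingHyp) (m x : ℕ) (hm : 1 ≤ m) (hx : 1 ≤ x)
    (X : List ℕ) (hX : X ≠ []) (hsuf : (X ++ X ++ X) <:+ piStr m x) :
    ∃ n t μ : ℕ, m ≤ n ∧ 1 ≤ t ∧ 1 ≤ μ ∧
      ∃ U V : List ℕ,
        (List.replicate μ (Bstr n t)).flatten = U ++ V ∧ X = V ++ U := by
  exact exists_conjugate_of_cube_suffix hSH _ m x hm rfl X hX hsuf
end
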